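/- For any k ≥ 2, a complete first-order theory T has weak k-TP₁ if and only if T has SOP₂. -/

import Mathlib

/- Common model-theoretic infrastructure for formalizing
   "NSOP₂ theories are NSOP₁" (arXiv:2206.08512).

   We work with a monster model `𝕄` of a complete theory: a sufficiently
   saturated and strongly homogeneous `L`-structure.  Tuples are functions
   `α → 𝕄`; sets of formulas with parameters are coded via `FmlP`. -/

open FirstOrder Language

universe u v w

namespace NSOP2Paper

/-- A first-order formula in free variables `α ⊕ Fin n` together with an
`n`-tuple of parameters from `𝕄`. -/
abbrev FmlP (L : FirstOrder.Language.{u, u}) (𝕄 : Type u) (α : Type v) :=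
  Σ n : ℕ, L.Formula (α ⊕ Fin n) × (Fin n → 𝕄)

/-- `a ≡_C b` : the tuples `a` and `b` satisfy the same formulas with
parameters from `C`. -/
def EqTpOver (L : FirstOrder.Language.{u, u}) {𝕄 : Type u} [L.Structure 𝕄] (C : Set 𝕄)
    {α : Type v} (a b : α → 𝕄) : Prop :=
  ∀ (n : ℕ) (φ : L.Formula (α ⊕ Fin n)) (c : Fin n → 𝕄), (∀ i, c i ∈ C) →
    (φ.Realize (Sum.elim a c) ↔ φ.Realize (Sum.elim b c))

/-- `tp(a / C)` is finitely satisfiable in `Ms`: every formula over `C`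
satisfied by `a` has a realization by a tuple from `Ms`. -/
def FinSatIn (L : FirstOrder.Language.{u, u}) {𝕄 : Type u} [L.Structure 𝕄] (Ms : Set 𝕄)
    {α : Type v} (a : α → 𝕄) (C : Set 𝕄) : Prop :=
  ∀ (n : ℕ) (φ : L.Formula (α ⊕ Fin n)) (c : Fin n → 𝕄), (∀ i, c i ∈ C) →
    φ.Realize (Sum.elim a c) →
    ∃ m : α → 𝕄, (∀ i, m i ∈ Ms) ∧ φ.Realize (Sum.elim m c)

/-- `Ms` is the underlying set of a (small) elementary submodel of `𝕄`. -/
def IsElemSubmodel (L : FirstOrder.Language.{u, u}) {𝕄 : Type u} [L.Structure 𝕄] (Ms : Set 𝕄) : Prop :=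
  ∃ S : L.ElementarySubstructure 𝕄, (S : Set 𝕄) = Ms

/-- A complete consistent global type (a complete type over the monster `𝕄`)
in variables `α`, coded as the set of formulas-with-parameters it contains. -/
structure GlobalType (L : FirstOrder.Language.{u, u}) (𝕄 : Type u) [L.Structure 𝕄] (α : Type v) where
  carrier : Set (FmlP L 𝕄 α)
  consistent : ∀ t : Finset (FmlP L 𝕄 α), ↑t ⊆ carrier →
    ∃ a : α → 𝕄, ∀ p ∈ t, p.2.1.Realize (Sum.elim a p.2.2)
  complete : ∀ (n : ℕ) (φ : L.Formula (α ⊕ Fin n)) (c : Fin n → 𝕄),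
    (⟨n, (φ, c)⟩ : FmlP L 𝕄 α) ∈ carrier ∨ (⟨n, (φ.not, c)⟩ : FmlP L 𝕄 α) ∈ carrier

variable {L : FirstOrder.Language.{u, u}} {𝕄 : Type u} [L.Structure 𝕄]

/-- The global type `q` is finitely satisfiable in `Ms` (i.e. it is a coheir of
its restriction to `Ms`). -/
def GlobalType.FinSatInM {α : Type v} (q : GlobalType L 𝕄 α) (Ms : Set 𝕄) : Prop :=
  ∀ t : Finset (FmlP L 𝕄 α), ↑t ⊆ q.carrier →
    ∃ m : α → 𝕄, (∀ i, m i ∈ Ms) ∧ ∀ p ∈ t, p.2.1.Realize (Sum.elim m p.2.2)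

/-- `a ⊨ q|_C` : the tuple `a` realizes the restriction of the global type `q`
to parameters from `C`. -/
def RealizesType {α : Type v} (q : GlobalType L 𝕄 α) (a : α → 𝕄) (C : Set 𝕄) : Prop :=
  ∀ (n : ℕ) (φ : L.Formula (α ⊕ Fin n)) (c : Fin n → 𝕄), (∀ i, c i ∈ C) →
    (⟨n, (φ, c)⟩ : FmlP L 𝕄 α) ∈ q.carrier → φ.Realize (Sum.elim a c)

/-- The global type `q` extends `tp(a / C)`. -/
def ExtendsTpOver {α : Type v} (q : GlobalType L 𝕄 α) (C : Set 𝕄) (a : α → 𝕄) : Prop :=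
  ∀ (n : ℕ) (φ : L.Formula (α ⊕ Fin n)) (c : Fin n → 𝕄), (∀ i, c i ∈ C) →
    φ.Realize (Sum.elim a c) → (⟨n, (φ, c)⟩ : FmlP L 𝕄 α) ∈ q.carrier

/-- `B` is a coheir Morley sequence over `Ms` in the global type `q`:
`q` is finitely satisfiable in `Ms` and `B i ⊨ q|_(Ms ∪ B_{<i})`. -/
def MorleyIn {α : Type v} (q : GlobalType L 𝕄 α) (Ms : Set 𝕄) (B : ℕ → α → 𝕄) : Prop :=
  q.FinSatInM Ms ∧
    ∀ i : ℕ, RealizesType q (B i) (Ms ∪ ⋃ (j : ℕ) (_ : j < i), Set.range (B j))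

/-- `B` is a coheir Morley sequence over `Ms`. -/
def CoheirMorley (L : FirstOrder.Language.{u, u}) {𝕄 : Type u} [L.Structure 𝕄] (Ms : Set 𝕄)
    {α : Type v} (B : ℕ → α → 𝕄) : Prop :=
  ∃ q : GlobalType L 𝕄 α, MorleyIn q Ms B

/-- Flatten an `ℕ`-indexed sequence of `α`-tuples into a single tuple. -/
def flatSeq {α : Type v} (I : ℕ → α → 𝕄) : ℕ × α → 𝕄 := fun p => I p.1 p.2

/-- The sequence `I` is indiscernible over `C`. -/
def IndiscernibleOver (L : FirstOrder.Language.{u, u}) {𝕄 : Type u} [L.Structure 𝕄] (C : Set 𝕄)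
    {α : Type v} (I : ℕ → α → 𝕄) : Prop :=
  ∀ (n : ℕ) (f g : Fin n → ℕ), StrictMono f → StrictMono g →
    EqTpOver L C (fun p : Fin n × α => I (f p.1) p.2) (fun p : Fin n × α => I (g p.1) p.2)

/-- `𝕄` is `κ`-saturated: every finitely satisfiable set of formulas in fewer
than `κ` variables over a parameter set of size `< κ` is realized in `𝕄`. -/
def IsSaturated (L : FirstOrder.Language.{u, u}) (𝕄 : Type u) [L.Structure 𝕄] (κ : Cardinal.{u}) : Prop :=
  ∀ (α : Type u) (A : Set 𝕄), Cardinal.mk α < κ → Cardinal.mk A < κ →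
    ∀ Γ : Set (FmlP L 𝕄 α), (∀ p ∈ Γ, ∀ i, p.2.2 i ∈ A) →
      (∀ t : Finset (FmlP L 𝕄 α), ↑t ⊆ Γ →
        ∃ a : α → 𝕄, ∀ p ∈ t, p.2.1.Realize (Sum.elim a p.2.2)) →
      ∃ a : α → 𝕄, ∀ p ∈ Γ, p.2.1.Realize (Sum.elim a p.2.2)

/-- `𝕄` is strongly `κ`-homogeneous: partial elementary maps between tuples of
length `< κ` extend to automorphisms of `𝕄`. -/
def IsStronglyHomogeneous (L : FirstOrder.Language.{u, u}) (𝕄 : Type u) [L.Structure 𝕄]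
    (κ : Cardinal.{u}) : Prop :=
  ∀ (α : Type u), Cardinal.mk α < κ → ∀ a b : α → 𝕄, EqTpOver L (∅ : Set 𝕄) a b →
    ∃ σ : 𝕄 ≃[L] 𝕄, ∀ i, σ (a i) = b i

/-- `𝕄` is a monster model (for smallness degree `κ`): sufficiently saturated
and strongly homogeneous. -/
def IsMonster (L : FirstOrder.Language.{u, u}) (𝕄 : Type u) [L.Structure 𝕄] (κ : Cardinal.{u}) : Prop :=
  Cardinal.aleph0 < κ ∧ IsSaturated L 𝕄 κ ∧ IsStronglyHomogeneous L 𝕄 κ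

/-! ### Tree combinatorics -/

/-- The meet (longest common prefix) of two finite sequences. -/
def meet {A : Type w} [DecidableEq A] : List A → List A → List A
  | a :: as, b :: bs => if a = b then a :: meet as bs else []
  | _, _ => []

/-- The meet of `η 0, …, η i`. -/
def combMeet {A : Type w} [DecidableEq A] {k : ℕ} (η : Fin k → List A) (i : Fin k) : List A :=
  (List.ofFn fun j : Fin i.val => η (Fin.castLE i.2.le j)).foldl meet (η i)

/-- `η 0, …, η (k-1)` is a descending comb: a lexicographically increasing
antichain such that the meet of `η 0, …, η (i+1)` is a proper initial segment
of the meet of `η 0, …, η i`. -/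
def DescendingComb {A : Type w} [DecidableEq A] [LT A] {k : ℕ} (η : Fin k → List A) : Prop :=
  (∀ i j : Fin k, i ≠ j → ¬ η i <+: η j) ∧
  (∀ i j : Fin k, i < j → List.Lex (· < ·) (η i) (η j)) ∧
  (∀ (i : ℕ) (h : i + 1 < k),
    combMeet η ⟨i + 1, h⟩ <+: combMeet η ⟨i, by omega⟩ ∧
    combMeet η ⟨i + 1, h⟩ ≠ combMeet η ⟨i, by omega⟩)

/-! ### Tree properties of theories (witnessed in the monster model) -/

/-- `T = Th(𝕄)` has `SOP₁`. -/
def HasSOP1 (L : FirstOrder.Language.{u, u}) (𝕄 : Type u) [L.Structure 𝕄] : Prop :=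
  ∃ (k m : ℕ) (φ : L.Formula (Fin k ⊕ Fin m)) (b : List Bool → Fin m → 𝕄),
    (∀ σ : ℕ → Bool, ∃ a : Fin k → 𝕄,
      ∀ n : ℕ, φ.Realize (Sum.elim a (b (List.ofFn fun i : Fin n => σ i)))) ∧
    ∀ η₁ η₂ : List Bool, (η₁ ++ [false]) <+: η₂ →
      ¬ ∃ a : Fin k → 𝕄, φ.Realize (Sum.elim a (b η₂)) ∧
        φ.Realize (Sum.elim a (b (η₁ ++ [true])))

/-- `T = Th(𝕄)` has `SOP₂`. -/
def HasSOP2 (L : FirstOrder.Language.{u, u}) (𝕄 : Type u) [L.Structure 𝕄] : Prop :=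
  ∃ (k m : ℕ) (φ : L.Formula (Fin k ⊕ Fin m)) (b : List Bool → Fin m → 𝕄),
    (∀ σ : ℕ → Bool, ∃ a : Fin k → 𝕄,
      ∀ n : ℕ, φ.Realize (Sum.elim a (b (List.ofFn fun i : Fin n => σ i)))) ∧
    ∀ η₁ η₂ : List Bool, ¬ η₁ <+: η₂ → ¬ η₂ <+: η₁ →
      ¬ ∃ a : Fin k → 𝕄, φ.Realize (Sum.elim a (b η₁)) ∧ φ.Realize (Sum.elim a (b η₂))

/-- `T = Th(𝕄)` has `k`-`DCTP₁`: paths are consistent but descending combs of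
size `k` are inconsistent. -/
def HasKDCTP1 (L : FirstOrder.Language.{u, u}) (𝕄 : Type u) [L.Structure 𝕄] (k : ℕ) : Prop :=
  ∃ (r m : ℕ) (φ : L.Formula (Fin r ⊕ Fin m)) (b : List ℕ → Fin m → 𝕄),
    (∀ σ : ℕ → ℕ, ∃ a : Fin r → 𝕄,
      ∀ n : ℕ, φ.Realize (Sum.elim a (b (List.ofFn fun i : Fin n => σ i)))) ∧
    ∀ η : Fin k → List ℕ, DescendingComb η →
      ¬ ∃ a : Fin r → 𝕄, ∀ i, φ.Realize (Sum.elim a (b (η i)))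

/-- `T = Th(𝕄)` has weak `k`-`TP₁`: paths are consistent but any `k` pairwise
incomparable nodes with common pairwise meet are inconsistent. -/
def HasWeakKTP1 (L : FirstOrder.Language.{u, u}) (𝕄 : Type u) [L.Structure 𝕄] (k : ℕ) : Prop :=
  ∃ (r m : ℕ) (φ : L.Formula (Fin r ⊕ Fin m)) (b : List ℕ → Fin m → 𝕄),
    (∀ σ : ℕ → ℕ, ∃ a : Fin r → 𝕄,
      ∀ n : ℕ, φ.Realize (Sum.elim a (b (List.ofFn fun i : Fin n => σ i)))) ∧
    ∀ η : Fin k → List ℕ,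
      (∀ i j, i ≠ j → ¬ η i <+: η j) →
      (∀ i j i' j' : Fin k, i ≠ j → i' ≠ j' → meet (η i) (η j) = meet (η i') (η j')) →
      ¬ ∃ a : Fin r → 𝕄, ∀ i, φ.Realize (Sum.elim a (b (η i)))

/-- `T = Th(𝕄)` has `k`-`DCTP₂`: paths are `k`-inconsistent but descending
combs are consistent. -/
def HasKDCTP2 (L : FirstOrder.Language.{u, u}) (𝕄 : Type u) [L.Structure 𝕄] (k : ℕ) : Prop :=
  ∃ (r m : ℕ) (φ : L.Formula (Fin r ⊕ Fin m)) (b : List Bool → Fin m → 𝕄),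
    (∀ σ : ℕ → Bool, ∀ s : Finset ℕ, s.card = k →
      ¬ ∃ a : Fin r → 𝕄, ∀ n ∈ s,
        φ.Realize (Sum.elim a (b (List.ofFn fun i : Fin n => σ i)))) ∧
    ∀ (l : ℕ) (η : Fin l → List Bool), DescendingComb η →
      ∃ a : Fin r → 𝕄, ∀ i, φ.Realize (Sum.elim a (b (η i)))

/-! ### Kim-dividing and Conant-dividing, with respect to coheir Morley sequences -/

/-- `φ(x, b)` Kim-divides over `Ms`: some coheir Morley sequence over `Ms`
starting with `b` makes it inconsistent. -/
def KimDivides (L : FirstOrder.Language.{u, u}) {𝕄 : Type u} [L.Structure 𝕄] (Ms : Set 𝕄)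
    {α : Type v} {n : ℕ} (φ : L.Formula (α ⊕ Fin n)) (b : Fin n → 𝕄) : Prop :=
  ∃ B : ℕ → Fin n → 𝕄, CoheirMorley L Ms B ∧ B 0 = b ∧
    ¬ ∃ a : α → 𝕄, ∀ i, φ.Realize (Sum.elim a (B i))

/-- `φ(x, b)` Kim-forks over `Ms`: it implies a finite disjunction of formulas
Kim-dividing over `Ms`. -/
def KimForks (L : FirstOrder.Language.{u, u}) {𝕄 : Type u} [L.Structure 𝕄] (Ms : Set 𝕄)
    {α : Type v} {n : ℕ} (φ : L.Formula (α ⊕ Fin n)) (b : Fin n → 𝕄) : Prop :=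
  ∃ (N : ℕ) (m : Fin N → ℕ) (ψ : ∀ j : Fin N, L.Formula (α ⊕ Fin (m j)))
    (c : ∀ j : Fin N, Fin (m j) → 𝕄),
    (∀ j, KimDivides L Ms (ψ j) (c j)) ∧
    ∀ a : α → 𝕄, φ.Realize (Sum.elim a b) → ∃ j, (ψ j).Realize (Sum.elim a (c j))

/-- `φ(x, b)` Conant-divides over `Ms`: every coheir Morley sequence over `Ms`
starting with `b` makes it inconsistent. -/
def ConantDivides (L : FirstOrder.Language.{u, u}) {𝕄 : Type u} [L.Structure 𝕄] (Ms : Set 𝕄)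
    {α : Type v} {n : ℕ} (φ : L.Formula (α ⊕ Fin n)) (b : Fin n → 𝕄) : Prop :=
  ∀ B : ℕ → Fin n → 𝕄, CoheirMorley L Ms B → B 0 = b →
    ¬ ∃ a : α → 𝕄, ∀ i, φ.Realize (Sum.elim a (B i))

/-- `φ(x, b)` Conant-forks over `Ms`. -/
def ConantForks (L : FirstOrder.Language.{u, u}) {𝕄 : Type u} [L.Structure 𝕄] (Ms : Set 𝕄)
    {α : Type v} {n : ℕ} (φ : L.Formula (α ⊕ Fin n)) (b : Fin n → 𝕄) : Prop :=
  ∃ (N : ℕ) (m : Fin N → ℕ) (ψ : ∀ j : Fin N, L.Formula (α ⊕ Fin (m j)))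
    (c : ∀ j : Fin N, Fin (m j) → 𝕄),
    (∀ j, ConantDivides L Ms (ψ j) (c j)) ∧
    ∀ a : α → 𝕄, φ.Realize (Sum.elim a b) → ∃ j, (ψ j).Realize (Sum.elim a (c j))

/-- `a ⫝^{K*}_{Ms} b` : `tp(a/Ms b)` contains no formula Conant-forking
over `Ms`. -/
def ConantIndep (L : FirstOrder.Language.{u, u}) {𝕄 : Type u} [L.Structure 𝕄] (Ms : Set 𝕄)
    {α : Type v} {β : Type w} (a : α → 𝕄) (b : β → 𝕄) : Prop :=
  ∀ (n : ℕ) (φ : L.Formula (α ⊕ Fin n)) (d : Fin n → 𝕄),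
    (∀ i, d i ∈ Ms ∪ Set.range b) → φ.Realize (Sum.elim a d) →
    ¬ ConantForks L Ms φ d

/-! ### Abstract independence relations between sets over models -/

/-- An abstract ternary relation `A ⫝_M B` between subsets of `𝕄` over
(elementary submodels of) `𝕄`. -/
structure IndRel (L : FirstOrder.Language.{u, u}) (𝕄 : Type u) [L.Structure 𝕄] where
  rel : Set 𝕄 → Set 𝕄 → Set 𝕄 → Prop

/-- A set `S` of `α`-tuples is type-definable over `C`. -/
def TypeDefinableOver (L : FirstOrder.Language.{u, u}) {𝕄 : Type u} [L.Structure 𝕄] (C : Set 𝕄)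
    {γ : Type v} (S : Set (γ → 𝕄)) : Prop :=
  ∃ Γ : Set (FmlP L 𝕄 γ), (∀ p ∈ Γ, ∀ i, p.2.2 i ∈ C) ∧
    ∀ g : γ → 𝕄, g ∈ S ↔ ∀ p ∈ Γ, p.2.1.Realize (Sum.elim g p.2.2)

namespace IndRel


/-- Invariance under automorphisms of `𝕄`. -/
def Invariant (R : IndRel L 𝕄) : Prop :=
  ∀ (σ : 𝕄 ≃[L] 𝕄) (A Ms B : Set 𝕄), R.rel A Ms B →
    R.rel ((⇑σ) '' A) ((⇑σ) '' Ms) ((⇑σ) '' B)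

/-- Monotonicity (on both sides). -/
def Mono (R : IndRel L 𝕄) : Prop :=
  ∀ (A A' Ms B B' : Set 𝕄), IsElemSubmodel L Ms → R.rel A Ms B →
    Ms ⊆ A' → A' ⊆ A → Ms ⊆ B' → B' ⊆ B → R.rel A' Ms B'

/-- Existence: for `M ⊆ A, B` there is `A' ≡_M A` with `A' ⫝_M B`. -/
def Existence (R : IndRel L 𝕄) (κ : Cardinal.{u}) : Prop :=
  ∀ (Ms : Set 𝕄), IsElemSubmodel L Ms → Cardinal.mk Ms < κ →
    ∀ (α β : Type u), Cardinal.mk α < κ → Cardinal.mk β < κ →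
      ∀ (a : α → 𝕄) (b : β → 𝕄),
        ∃ a' : α → 𝕄, EqTpOver L Ms a' a ∧
          R.rel (Ms ∪ Set.range a') Ms (Ms ∪ Set.range b)

/-- Right extension. -/
def RightExt (R : IndRel L 𝕄) (κ : Cardinal.{u}) : Prop :=
  ∀ (Ms : Set 𝕄), IsElemSubmodel L Ms → Cardinal.mk Ms < κ →
    ∀ (α : Type u), Cardinal.mk α < κ → ∀ (a : α → 𝕄) (B C : Set 𝕄),
      Cardinal.mk B < κ → Cardinal.mk C < κ →
      R.rel (Set.range a) Ms B → B ⊆ C →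
      ∃ a' : α → 𝕄, EqTpOver L B a' a ∧ R.rel (Set.range a') Ms C

/-- Quasi-strong finite character: for complete types `p = tp(a₀/Ms)` and
`q = tp(b₀/Ms)`, the set of pairs of realizations `(a, b)` with `a ⫝_Ms b`
is type-definable over `Ms`. -/
def QSFC (R : IndRel L 𝕄) (κ : Cardinal.{u}) : Prop :=
  ∀ (Ms : Set 𝕄), IsElemSubmodel L Ms → Cardinal.mk Ms < κ →
    ∀ (α β : Type u), Cardinal.mk α < κ → Cardinal.mk β < κ →
      ∀ (a₀ : α → 𝕄) (b₀ : β → 𝕄),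
        TypeDefinableOver L Ms {g : (α ⊕ β) → 𝕄 |
          EqTpOver L Ms (g ∘ Sum.inl) a₀ ∧ EqTpOver L Ms (g ∘ Sum.inr) b₀ ∧
          R.rel (Set.range (g ∘ Sum.inl)) Ms (Set.range (g ∘ Sum.inr))}

/-- The coheir chain condition. -/
def CoheirChain (R : IndRel L 𝕄) (κ : Cardinal.{u}) : Prop :=
  ∀ (Ms : Set 𝕄), IsElemSubmodel L Ms → Cardinal.mk Ms < κ →
    ∀ (α β : Type u), Cardinal.mk α < κ → Cardinal.mk β < κ →
      ∀ (a : α → 𝕄) (b : β → 𝕄), R.rel (Set.range a) Ms (Set.range b) →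
        ∀ I : ℕ → β → 𝕄, CoheirMorley L Ms I → I 0 = b →
          ∃ I' : ℕ → β → 𝕄, EqTpOver L Ms (flatSeq I') (flatSeq I) ∧
            R.rel (Set.range a) Ms (⋃ i, Set.range (I' i)) ∧
            ∀ i, EqTpOver L (Ms ∪ Set.range a) (I' i) b

/-- `R` implies `⫝ʰ` : `A ⫝_M B` implies `tp(B / M A)` is finitely
satisfiable in `M`. -/
def StrongerThanH (R : IndRel L 𝕄) : Prop :=
  ∀ (A Ms B : Set 𝕄), IsElemSubmodel L Ms → R.rel A Ms B →
    FinSatIn L Ms (fun x : B => (x : 𝕄)) (Ms ∪ A)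

end IndRel

/-- The axioms satisfied by the relations among which `⫝^CK` is weakest. -/
def GoodRel (R : IndRel L 𝕄) (κ : Cardinal.{u}) : Prop :=
  R.StrongerThanH ∧ R.Invariant ∧ R.Mono ∧ R.Existence κ ∧ R.RightExt κ ∧ R.CoheirChain κ

/-- `R` is `⫝^CK` : the weakest relation implying `⫝ʰ` and satisfying
invariance, monotonicity, existence, right extension and the coheir chain
condition. -/
def IsCK (R : IndRel L 𝕄) (κ : Cardinal.{u}) : Prop :=
  GoodRel R κ ∧ ∀ R' : IndRel L 𝕄, GoodRel R' κ →
    ∀ A Ms B : Set 𝕄, R'.rel A Ms B → R.rel A Ms B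

/-- `q` is a canonical global type over `Ms` (w.r.t. the relation `R = ⫝^CK`):
whenever `c ⊨ q|_{Ms b}` we have `b ⫝^CK_{Ms} c`. -/
def IsCanonicalGlobal (R : IndRel L 𝕄) (κ : Cardinal.{u}) (Ms : Set 𝕄) {α : Type v}
    (q : GlobalType L 𝕄 α) : Prop :=
  ∀ (β : Type u), Cardinal.mk β < κ → ∀ (b : β → 𝕄) (c : α → 𝕄),
    RealizesType q c (Ms ∪ Set.range b) → R.rel (Set.range b) Ms (Set.range c)

/-- A canonical Morley sequence over `Ms`: a coheir Morley sequence in a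
canonical coheir. -/
def CanonicalMorley (R : IndRel L 𝕄) (κ : Cardinal.{u}) (Ms : Set 𝕄) {α : Type v}
    (I : ℕ → α → 𝕄) : Prop :=
  ∃ q : GlobalType L 𝕄 α, IsCanonicalGlobal R κ Ms q ∧ MorleyIn q Ms I

/-- `q` is a strong canonical global type over `Ms`. -/
def IsStrongCanonical (R : IndRel L 𝕄) (κ : Cardinal.{u}) (Ms : Set 𝕄) {α : Type v}
    (q : GlobalType L 𝕄 α) : Prop :=
  ∀ (β : Type u), Cardinal.mk β < κ → ∀ (b : β → 𝕄) (c : α → 𝕄),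
    RealizesType q c (Ms ∪ Set.range b) →
    ∀ (γ : Type u), Cardinal.mk γ < κ → ∀ (a : γ → 𝕄),
      ∃ a' : γ → 𝕄, EqTpOver L (Ms ∪ Set.range c) a' a ∧
        ∃ q' : GlobalType L 𝕄 (γ ⊕ α), IsCanonicalGlobal R κ Ms q' ∧
          ExtendsTpOver q' (Ms ∪ Set.range b) (Sum.elim a' c)

/-! ### `M`-invariant ideals and `𝓘`-Kim-dividing -/

/-- An `Ms`-invariant ideal on the definable subsets of `𝕄` (in variables `α`). -/
structure InvIdeal (L : FirstOrder.Language.{u, u}) (𝕄 : Type u) [L.Structure 𝕄] (Ms : Set 𝕄)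
    (α : Type v) where
  mem : Set (α → 𝕄) → Prop
  definable_of_mem : ∀ S, mem S → ∃ (n : ℕ) (ψ : L.Formula (α ⊕ Fin n)) (c : Fin n → 𝕄),
    S = {a : α → 𝕄 | ψ.Realize (Sum.elim a c)}
  union_mem : ∀ S T, mem S → mem T → mem (S ∪ T)
  subset_mem : ∀ S T, mem S →
    (∃ (n : ℕ) (ψ : L.Formula (α ⊕ Fin n)) (c : Fin n → 𝕄),
      T = {a : α → 𝕄 | ψ.Realize (Sum.elim a c)}) →
    T ⊆ S → mem T
  invariant : ∀ σ : 𝕄 ≃[L] 𝕄, (∀ x ∈ Ms, σ x = x) → ∀ S, mem S →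
    mem ((fun a => (⇑σ) ∘ a) '' S)

/-- `φ(x, b)` `𝓘`-Kim-divides over `Ms`. -/
def IKimDivides {Ms : Set 𝕄} {α : Type v} (I : InvIdeal L 𝕄 Ms α) {n : ℕ}
    (φ : L.Formula (α ⊕ Fin n)) (b : Fin n → 𝕄) : Prop :=
  ∃ (B : ℕ → Fin n → 𝕄) (k : ℕ), CoheirMorley L Ms B ∧ B 0 = b ∧ 0 < k ∧
    ∀ s : Finset ℕ, s.card = k →
      I.mem {a : α → 𝕄 | ∀ i ∈ s, φ.Realize (Sum.elim a (B i))}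

/-- `φ(x, b)` `𝓘`-Kim-forks over `Ms`. -/
def IKimForks {Ms : Set 𝕄} {α : Type v} (I : InvIdeal L 𝕄 Ms α) {n : ℕ}
    (φ : L.Formula (α ⊕ Fin n)) (b : Fin n → 𝕄) : Prop :=
  ∃ (N : ℕ) (m : Fin N → ℕ) (ψ : ∀ j : Fin N, L.Formula (α ⊕ Fin (m j)))
    (c : ∀ j : Fin N, Fin (m j) → 𝕄),
    (∀ j, IKimDivides I (ψ j) (c j)) ∧
    ∀ a : α → 𝕄, φ.Realize (Sum.elim a b) → ∃ j, (ψ j).Realize (Sum.elim a (c j))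

/-- `φ(x, b)` `𝓘`-quasi-divides over `Ms`. -/
def IQuasiDivides {Ms : Set 𝕄} {α : Type v} (I : InvIdeal L 𝕄 Ms α) {n : ℕ}
    (φ : L.Formula (α ⊕ Fin n)) (b : Fin n → 𝕄) : Prop :=
  ∃ (mm : ℕ) (b' : Fin mm → Fin n → 𝕄), 0 < mm ∧ (∀ j, EqTpOver L Ms (b' j) b) ∧
    I.mem {a : α → 𝕄 | ∀ j, φ.Realize (Sum.elim a (b' j))}

/-! ### `h^⫝`-inconsistency and the derived relation `⫝'` -/

/-- A family of formulas is `h^⫝`-inconsistent with respect to `P = tp(a₀/Ms)`. -/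
def HInconsistent (R : IndRel L 𝕄) (Ms : Set 𝕄) {α : Type v} (a₀ : α → 𝕄)
    {ι : Type w} (m : ι → ℕ) (φ : ∀ i : ι, L.Formula (α ⊕ Fin (m i)))
    (b : ∀ i : ι, Fin (m i) → 𝕄) : Prop :=
  ¬ ∃ a : α → 𝕄, EqTpOver L Ms a a₀ ∧
      R.rel (Set.range a) Ms (⋃ i, Set.range (b i)) ∧
      ∀ i, (φ i).Realize (Sum.elim a (b i))

/-- A single formula is `h^⫝`-inconsistent with respect to `P = tp(a₀/Ms)`. -/
def HInconsistentSingle (R : IndRel L 𝕄) (Ms : Set 𝕄) {α : Type v} (a₀ : α → 𝕄)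
    {n : ℕ} (φ : L.Formula (α ⊕ Fin n)) (b : Fin n → 𝕄) : Prop :=
  ¬ ∃ a : α → 𝕄, EqTpOver L Ms a a₀ ∧ R.rel (Set.range a) Ms (Set.range b) ∧
      φ.Realize (Sum.elim a b)

/-- `φ(x, b)` `h^⫝`-Kim-divides with respect to `tp(a₀/Ms)`. -/
def HKimDivides (R : IndRel L 𝕄) (Ms : Set 𝕄) {α : Type v} (a₀ : α → 𝕄)
    {n : ℕ} (φ : L.Formula (α ⊕ Fin n)) (b : Fin n → 𝕄) : Prop :=
  ∃ B : ℕ → Fin n → 𝕄, CoheirMorley L Ms B ∧ B 0 = b ∧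
    HInconsistent R Ms a₀ (fun _ : ℕ => n) (fun _ => φ) B

/-- `φ(x, b)` `h^⫝`-Kim-forks with respect to `tp(a₀/Ms)`. -/
def HKimForks (R : IndRel L 𝕄) (Ms : Set 𝕄) {α : Type v} (a₀ : α → 𝕄)
    {n : ℕ} (φ : L.Formula (α ⊕ Fin n)) (b : Fin n → 𝕄) : Prop :=
  ∃ (N : ℕ) (m : Fin N → ℕ) (ψ : ∀ j : Fin N, L.Formula (α ⊕ Fin (m j)))
    (c : ∀ j : Fin N, Fin (m j) → 𝕄),
    (∀ j, HKimDivides R Ms a₀ (ψ j) (c j)) ∧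
    ∀ a : α → 𝕄, φ.Realize (Sum.elim a b) → ∃ j, (ψ j).Realize (Sum.elim a (c j))

/-- `φ(x, b)` `h^⫝`-quasi-divides with respect to `tp(a₀/Ms)`. -/
def HQuasiDivides (R : IndRel L 𝕄) (Ms : Set 𝕄) {α : Type v} (a₀ : α → 𝕄)
    {n : ℕ} (φ : L.Formula (α ⊕ Fin n)) (b : Fin n → 𝕄) : Prop :=
  ∃ (mm : ℕ) (b' : Fin mm → Fin n → 𝕄), 0 < mm ∧ (∀ j, EqTpOver L Ms (b' j) b) ∧
    HInconsistent R Ms a₀ (fun _ : Fin mm => n) (fun _ => φ) b'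

/-- The derived relation `⫝'` on tuples:
`tp(a / Ms b)` contains no formula `h^⫝`-Kim-forking w.r.t. `tp(a/Ms)`. -/
def DerivedIndep (R : IndRel L 𝕄) (Ms : Set 𝕄) {α : Type v} {β : Type w}
    (a : α → 𝕄) (b : β → 𝕄) : Prop :=
  ∀ (n : ℕ) (φ : L.Formula (α ⊕ Fin n)) (d : Fin n → 𝕄),
    (∀ i, d i ∈ Ms ∪ Set.range b) → φ.Realize (Sum.elim a d) →
    ¬ HKimForks R Ms a φ d

/-- The derived relation `⫝'` as a relation between sets over models. -/
def derived (R : IndRel L 𝕄) : IndRel L 𝕄 where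
  rel A Ms B := ∀ (n : ℕ) (φ : L.Formula (↥A ⊕ Fin n)) (d : Fin n → 𝕄),
    (∀ i, d i ∈ Ms ∪ B) → φ.Realize (Sum.elim (fun x : A => (x : 𝕄)) d) →
    ¬ HKimForks R Ms (fun x : A => (x : 𝕄)) φ d

/-! ### Coheir trees -/

/-- The tuple, indexed by extensions, consisting of the part of the tree `c`
lying (weakly) above the node `ν` (where `ν` has length `Lh`). -/
def subtreeTupleLen {α : Type v} {n : ℕ} (c : {l : List ℕ // l.length ≤ n} → α → 𝕄)
    (Lh : ℕ) (ν : List ℕ) (hν : ν.length = Lh) :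
    ({s : List ℕ // Lh + s.length ≤ n} × α) → 𝕄 :=
  fun p => c ⟨ν ++ p.1.1, by rw [List.length_append, hν]; exact p.1.2⟩ p.2

end NSOP2Paper

namespace NSOP2Paper

/-! ### Saturation -/

theorem IsSaturated.realize_of_finite {L : FirstOrder.Language.{u, u}} {𝕄 : Type u} [L.Structure 𝕄]
    {κ : Cardinal.{u}} (hκ : Cardinal.aleph0 < κ) (hsat : IsSaturated L 𝕄 κ)
    {α : Type} [Countable α] {ι : Type w} (n : ι → ℕ) (ψ : ∀ i, L.Formula (α ⊕ Fin (n i)))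
    (p : ∀ i, Fin (n i) → 𝕄) (hp : (⋃ i, Set.range (p i)).Countable)
    (hfin : ∀ s : Finset ι, ∃ a : α → 𝕄, ∀ i ∈ s, (ψ i).Realize (Sum.elim a (p i))) :
    ∃ a : α → 𝕄, ∀ i, (ψ i).Realize (Sum.elim a (p i)) := by
  classical
  let F : ι → FmlP L 𝕄 (ULift.{u} α) := fun i =>
    ⟨n i, (ψ i).relabel (Sum.map ULift.up id), p i⟩
  have key : ∀ i (a : ULift.{u} α → 𝕄), (F i).2.1.Realize (Sum.elim a (F i).2.2) ↔
      (ψ i).Realize (Sum.elim (a ∘ ULift.up) (p i)) := by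
    intro i a
    simp only [F, Formula.realize_relabel]
    rw [Sum.elim_comp_map, Function.comp_id]
  obtain ⟨a, ha⟩ := hsat (ULift.{u} α) (⋃ i, Set.range (p i))
    (lt_of_le_of_lt (Cardinal.mk_le_aleph0) hκ)
    (lt_of_le_of_lt (Cardinal.le_aleph0_iff_set_countable.2 hp) hκ)
    (Set.range F)
    (by
      rintro _ ⟨i, rfl⟩ j
      exact Set.mem_iUnion.2 ⟨i, j, rfl⟩)
    (by
      intro t ht
      obtain ⟨s, -, rfl⟩ := Finset.subset_set_image_iff.1
        (show (t : Set _) ⊆ F '' Set.univ by simpa using ht)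
      obtain ⟨a, ha⟩ := hfin s
      refine ⟨a ∘ ULift.down, fun q hq => ?_⟩
      obtain ⟨i, hi, rfl⟩ := Finset.mem_image.1 hq
      exact (key i _).2 (ha i hi))
  exact ⟨a ∘ ULift.up, fun i => (key i a).1 (ha _ ⟨i, rfl⟩)⟩

/-! ### Iterated ultrafilter quantifiers -/

section Gen

variable {I J : Type} [DecidableEq I] [DecidableEq J]

/-- `Gen [i₁, …, iₙ] P` says that for almost all values of the coordinate `i₁`, …, for almost all
values of the coordinate `iₙ`, the property `P` holds. -/
def Gen : List I → ((I → ℕ) → Prop) → Prop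
  | [], P => P fun _ => 0
  | a :: l, P => ∀ᶠ n in (Filter.hyperfilter ℕ : Filter ℕ), Gen l fun e => P (Function.update e a n)

theorem Gen.mono {l : List I} {P Q : (I → ℕ) → Prop} (h : ∀ e, P e → Q e) (hP : Gen l P) :
    Gen l Q := by
  induction l generalizing P Q with
  | nil => exact h _ hP
  | cons a l ih => exact Filter.Eventually.mono hP fun n hn => ih (fun e => h _) hn

theorem gen_congr {l : List I} {P Q : (I → ℕ) → Prop} (h : ∀ e, P e ↔ Q e) :
    Gen l P ↔ Gen l Q :=
  ⟨Gen.mono fun e => (h e).1, Gen.mono fun e => (h e).2⟩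

theorem gen_and {l : List I} {P Q : (I → ℕ) → Prop} :
    Gen l (fun e => P e ∧ Q e) ↔ Gen l P ∧ Gen l Q := by
  induction l generalizing P Q with
  | nil => exact Iff.rfl
  | cons a l ih =>
    simp only [Gen]
    rw [← Filter.eventually_and]
    exact Filter.eventually_congr (Filter.Eventually.of_forall fun n => ih)

theorem gen_not {l : List I} {P : (I → ℕ) → Prop} : Gen l (fun e => ¬ P e) ↔ ¬ Gen l P := by
  induction l generalizing P with
  | nil => exact Iff.rfl
  | cons a l ih =>
    simp only [Gen]
    rw [← Ultrafilter.eventually_not]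
    exact Filter.eventually_congr (Filter.Eventually.of_forall fun n => ih)

theorem Gen.exists {l : List I} {P : (I → ℕ) → Prop} (h : Gen l P) : ∃ e, P e := by
  by_contra hne
  push Not at hne
  have h2 : Gen l (fun _ => ¬ True) := h.mono fun e he => (hne e he).elim
  rw [gen_not] at h2
  apply h2
  clear h h2 hne
  induction l with
  | nil => trivial
  | cons a l ih => exact Filter.Eventually.of_forall fun _ => ih

theorem gen_const {l : List I} {p : Prop} : Gen l (fun _ => p) ↔ p := by
  constructor
  · exact fun h => h.exists.choose_spec
  · intro hp
    by_contra h
    rw [← gen_not] at h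
    exact h.exists.choose_spec hp

theorem gen_finset_forall {ι : Type w} {l : List I} (s : Finset ι) {P : ι → (I → ℕ) → Prop}
    (h : ∀ i ∈ s, Gen l (P i)) : Gen l (fun e => ∀ i ∈ s, P i e) := by
  classical
  induction s using Finset.induction_on with
  | empty => simp [gen_const]
  | insert a s ha ih =>
    simp only [Finset.forall_mem_insert] at h ⊢
    exact gen_and.2 ⟨h.1, ih h.2⟩

theorem gen_of_lt {l : List I} (hl : l.Nodup) (N : ℕ) {P : (I → ℕ) → Prop}
    (h : ∀ e : I → ℕ, (∀ i ∈ l, N < e i) → (l.map e).Pairwise (· < ·) → P e) : Gen l P := by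
  induction l generalizing N P with
  | nil => exact h _ (by simp) (by simp)
  | cons a l ih =>
    rw [List.nodup_cons] at hl
    have : ∀ᶠ n in (Filter.hyperfilter ℕ : Filter ℕ), N < n := by
      apply Filter.hyperfilter_le_cofinite
      rw [Nat.cofinite_eq_atTop]
      exact Filter.eventually_gt_atTop N
    refine this.mono fun n hn => ih hl.2 n fun e he hp => h _ ?_ ?_
    · intro i hi
      rcases List.mem_cons.1 hi with rfl | hi
      · simpa using hn
      · rw [Function.update_of_ne (ne_of_mem_of_not_mem hi hl.1)]
        exact hn.trans (he i hi)
    · have h1 : l.map (Function.update e a n) = l.map e :=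
        List.map_congr_left fun i hi =>
          Function.update_of_ne (ne_of_mem_of_not_mem hi hl.1) _ _
      rw [List.map_cons, h1, List.pairwise_cons]
      refine ⟨?_, hp⟩
      intro b hb
      obtain ⟨i, hi, rfl⟩ := List.mem_map.1 hb
      simpa using he i hi

theorem gen_filter (p : I → Prop) [DecidablePred p] {l : List I} {P : (I → ℕ) → Prop}
    (h : ∀ e e' : I → ℕ, (∀ i, p i → e i = e' i) → (P e ↔ P e')) :
    Gen l P ↔ Gen (l.filter (fun i => p i)) P := by
  induction l generalizing P with
  | nil => exact Iff.rfl
  | cons a l ih =>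
    by_cases ha : p a
    · rw [List.filter_cons_of_pos (by simpa using ha)]
      refine Filter.eventually_congr (Filter.Eventually.of_forall fun n => ih ?_)
      intro e e' hee
      refine h _ _ fun i hi => ?_
      by_cases hia : i = a
      · subst hia; simp
      · simp [Function.update_of_ne hia, hee i hi]
    · rw [List.filter_cons_of_neg (by simpa using ha), ← ih h]
      have : ∀ n, Gen l (fun e => P (Function.update e a n)) ↔ Gen l P := fun n =>
        gen_congr fun e => h _ _ fun i hi =>
          Function.update_of_ne (by rintro rfl; exact ha hi) _ _
      simp only [Gen, this]
      exact Filter.eventually_const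

theorem gen_map (f : I → J) {l : List I} (hl : (l.map f).Nodup) {P : (I → ℕ) → Prop}
    {Q : (J → ℕ) → Prop}
    (h : ∀ e e', (∀ i ∈ l, e i = e' (f i)) → (P e ↔ Q e')) :
    Gen l P ↔ Gen (l.map f) Q := by
  induction l generalizing P Q with
  | nil => exact h _ _ (by simp)
  | cons a l ih =>
    rw [List.map_cons, List.nodup_cons] at hl
    refine Filter.eventually_congr (Filter.Eventually.of_forall fun n => ih hl.2 ?_)
    intro e e' hee
    refine h _ _ fun i hi => ?_
    rcases List.mem_cons.1 hi with rfl | hi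
    · simp
    · have h1 : f i ≠ f a := fun h' => hl.1 (h' ▸ List.mem_map_of_mem hi)
      have h2 : i ≠ a := fun h' => h1 (h' ▸ rfl)
      rw [Function.update_of_ne h1, Function.update_of_ne h2, hee i hi]

end Gen

section GenericLimit

variable {I : Type} [LinearOrder I]

theorem gen_sort_of_subset {S S' : Finset I} (hS : S ⊆ S') {P : (I → ℕ) → Prop}
    (h : ∀ e e' : I → ℕ, (∀ i ∈ S, e i = e' i) → (P e ↔ P e')) :
    Gen (S.sort (· ≤ ·)) P ↔ Gen (S'.sort (· ≤ ·)) P := by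
  rw [gen_filter (fun i => i ∈ S) (l := S'.sort (· ≤ ·)) h]
  suffices S.sort (· ≤ ·) = (S'.sort (· ≤ ·)).filter (fun i => i ∈ S) by rw [this]
  refine List.Perm.eq_of_pairwise (le := (· ≤ ·)) (fun a b _ _ h1 h2 => le_antisymm h1 h2)
    (Finset.pairwise_sort _ _) ((Finset.pairwise_sort S' _).filter _) ?_
  rw [List.perm_ext_iff_of_nodup (Finset.sort_nodup _ _) ((Finset.sort_nodup _ _).filter _)]
  intro a
  simp only [Finset.mem_sort, List.mem_filter, decide_eq_true_eq]
  exact ⟨fun ha => ⟨hS ha, ha⟩, fun ha => ha.2⟩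

theorem gen_sort_map {J : Type} [LinearOrder J] {S : Finset I} (f : I → J)
    (hf : ∀ i ∈ S, ∀ j ∈ S, i < j → f i < f j)
    {P : (I → ℕ) → Prop} {Q : (J → ℕ) → Prop}
    (h : ∀ e e', (∀ i ∈ S, e i = e' (f i)) → (P e ↔ Q e')) :
    Gen (S.sort (· ≤ ·)) P ↔ Gen ((S.image f).sort (· ≤ ·)) Q := by
  have hsort : ((S.sort (· ≤ ·)).map f).Pairwise (· < ·) := by
    rw [List.pairwise_map]
    refine (Finset.sortedLT_sort S).pairwise.imp_of_mem ?_
    intro a b ha hb hab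
    exact hf a (by simpa using ha) b (by simpa using hb) hab
  have hnd : ((S.sort (· ≤ ·)).map f).Nodup := hsort.imp fun h => h.ne
  have : (S.image f).sort (· ≤ ·) = (S.sort (· ≤ ·)).map f := by
    refine List.Perm.eq_of_pairwise (le := (· ≤ ·)) (fun a b _ _ h1 h2 => le_antisymm h1 h2)
      (Finset.pairwise_sort _ _) (hsort.imp fun h => h.le) ?_
    rw [List.perm_ext_iff_of_nodup (Finset.sort_nodup _ _) hnd]
    intro a
    simp
  rw [this]
  exact gen_map f hnd fun e e' hee => h e e' fun i hi => hee i (by simpa using hi)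

/-- Every family of tuples `G e`, indexed by the functions `e : I → ℕ`, each entry depending on
finitely many coordinates only, has a limit along the iterated ultrafilter. -/
theorem exists_generic_limit {L : FirstOrder.Language.{u, u}} {𝕄 : Type u} [L.Structure 𝕄]
    {κ : Cardinal.{u}} (hκ : Cardinal.aleph0 < κ) (hsat : IsSaturated L 𝕄 κ)
    {α : Type} [Countable α] (G : (I → ℕ) → α → 𝕄) (supp : α → Finset I)
    (hG : ∀ x e e', (∀ i ∈ supp x, e i = e' i) → G e x = G e' x) :
    ∃ c : α → 𝕄, ∀ (n : ℕ) (ψ : L.Formula (Fin n)) (x : Fin n → α) (S : Finset I),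
      (∀ t, supp (x t) ⊆ S) →
      (ψ.Realize (c ∘ x) ↔ Gen (S.sort (· ≤ ·)) fun e => ψ.Realize (G e ∘ x)) := by
  have hdep : ∀ {n : ℕ} (ψ : L.Formula (Fin n)) (x : Fin n → α) (S : Finset I),
      (∀ t, supp (x t) ⊆ S) → ∀ e e' : I → ℕ, (∀ i ∈ S, e i = e' i) →
      (ψ.Realize (G e ∘ x) ↔ ψ.Realize (G e' ∘ x)) := by
    intro n ψ x S hS e e' hee
    have : G e ∘ x = G e' ∘ x := funext fun t => hG _ _ _ fun i hi => hee i (hS t hi)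
    rw [this]
  let ι := {q : Σ n : ℕ, L.Formula (Fin n) × (Fin n → α) //
    Gen ((Finset.univ.biUnion fun t => supp (q.2.2 t)).sort (· ≤ ·))
      fun e => q.2.1.Realize (G e ∘ q.2.2)}
  have hsub : ∀ {n : ℕ} (x : Fin n → α) (t : Fin n),
      supp (x t) ⊆ Finset.univ.biUnion fun t => supp (x t) := fun x t =>
    Finset.subset_biUnion_of_mem (fun t => supp (x t)) (Finset.mem_univ t)
  obtain ⟨c, hc⟩ := hsat.realize_of_finite hκ (ι := ι) (α := α) (fun _ => 0)
    (fun q => q.1.2.1.relabel (Sum.inl ∘ q.1.2.2)) (fun _ => Fin.elim0) (by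
      have : (⋃ _ : ι, Set.range (Fin.elim0 : Fin 0 → 𝕄)) = ∅ := by simp
      rw [this]; exact Set.countable_empty)
    (by
      intro s
      have := gen_finset_forall (l := (s.biUnion fun q : ι =>
        Finset.univ.biUnion fun t => supp (q.1.2.2 t)).sort (· ≤ ·)) s
        (P := fun q e => q.1.2.1.Realize (G e ∘ q.1.2.2)) (fun q hq => by
          rw [← gen_sort_of_subset (Finset.subset_biUnion_of_mem _ hq)
            (hdep _ _ _ (hsub _))]
          exact q.2)
      obtain ⟨e, he⟩ := this.exists
      refine ⟨G e, fun q hq => ?_⟩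
      rw [Formula.realize_relabel]
      exact he q hq)
  have h1 : ∀ (n : ℕ) (ψ : L.Formula (Fin n)) (x : Fin n → α) (S : Finset I),
      (∀ t, supp (x t) ⊆ S) → Gen (S.sort (· ≤ ·)) (fun e => ψ.Realize (G e ∘ x)) →
      ψ.Realize (c ∘ x) := by
    intro n ψ x S hS h
    have := hc ⟨⟨n, ψ, x⟩, by
      rwa [gen_sort_of_subset (S' := S) (Finset.biUnion_subset.2 fun t _ => hS t)
        (hdep _ _ _ (hsub _))]⟩
    rw [Formula.realize_relabel] at this
    exact this
  refine ⟨c, fun n ψ x S hS => ⟨fun h => ?_, h1 n ψ x S hS⟩⟩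
  by_contra hne
  rw [← gen_not] at hne
  exact h1 n ψ.not x S hS hne h

end GenericLimit

/-! ### Lists -/

section Lists

theorem prefix_or_prefix_or_split {A : Type w} (u v : List A) :
    u <+: v ∨ v <+: u ∨ ∃ ξ i i' s s', i ≠ i' ∧ u = ξ ++ i :: s ∧ v = ξ ++ i' :: s' := by
  induction u generalizing v with
  | nil => exact Or.inl List.nil_prefix
  | cons a u ih =>
    cases v with
    | nil => exact Or.inr (Or.inl List.nil_prefix)
    | cons b v =>
      by_cases hab : a = b
      · subst hab
        rcases ih v with h | h | ⟨ξ, i, i', s, s', hi, rfl, rfl⟩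
        · exact Or.inl (List.cons_prefix_cons.2 ⟨rfl, h⟩)
        · exact Or.inr (Or.inl (List.cons_prefix_cons.2 ⟨rfl, h⟩))
        · exact Or.inr (Or.inr ⟨a :: ξ, i, i', s, s', hi, rfl, rfl⟩)
      · exact Or.inr (Or.inr ⟨[], a, b, u, v, hab, rfl, rfl⟩)

theorem append_cons_lt_append_cons {A : Type w} [LinearOrder A] {a b : A} (h : a < b)
    (u v w : List A) : u ++ a :: v < u ++ b :: w :=
  List.append_left_lt (List.cons_lt_cons_iff.2 (Or.inl h))

theorem lt_append_cons {A : Type w} [LinearOrder A] (a : A) (u w : List A) : u < u ++ a :: w := by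
  simpa using List.append_left_lt (l₁ := u) (List.nil_lt_cons a w)

theorem lt_of_prefix_of_ne {A : Type w} [LinearOrder A] {u v : List A} (h : u <+: v)
    (hne : u ≠ v) : u < v := by
  obtain ⟨t, rfl⟩ := h
  cases t with
  | nil => simp at hne
  | cons a t => exact lt_append_cons a u t

theorem le_of_prefix {A : Type w} [LinearOrder A] {u v : List A} (h : u <+: v) : u ≤ v := by
  rcases eq_or_ne u v with rfl | hne
  · exact le_rfl
  · exact (lt_of_prefix_of_ne h hne).le

theorem lt_of_split {A : Type w} [LinearOrder A] {ξ u v : List A} {a b : A} (h : a < b)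
    (hu : ξ ++ [a] <+: u) (hv : ξ ++ [b] <+: v) : u < v := by
  obtain ⟨s, rfl⟩ := hu
  obtain ⟨t, rfl⟩ := hv
  simpa using append_cons_lt_append_cons h ξ s t

theorem prefix_cons_or {A : Type w} {ξ w u : List A} {a : A} (hu : ξ ++ [a] <+: u)
    (hw : w <+: u) : w <+: ξ ∨ ξ ++ [a] <+: w := by
  rcases List.prefix_or_prefix_of_prefix hw hu with h | h
  · rcases List.prefix_concat_iff.1 h with rfl | h
    · exact Or.inr List.prefix_rfl
    · exact Or.inl h
  · exact Or.inr h

end Lists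

/-! ### Consistent paths and inconsistent fans -/

section PathFan

variable {L : FirstOrder.Language.{u, u}} {𝕄 : Type u} [L.Structure 𝕄] {r m : ℕ}

/-- `φ` is consistent along every finite path of the tree `d`. -/
def ConsPath {A : Type} (φ : L.Formula (Fin r ⊕ Fin m)) (d : List A → Fin m → 𝕄) : Prop :=
  ∀ w : List A, ∃ a : Fin r → 𝕄, ∀ v, v <+: w → φ.Realize (Sum.elim a (d v))

/-- `φ` is inconsistent on any `K` nodes lying above distinct children of a common node. -/
def IncFan {A : Type} (K : ℕ) (φ : L.Formula (Fin r ⊕ Fin m)) (d : List A → Fin m → 𝕄) : Prop :=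
  ∀ (ξ : List A) (n : Fin K → A), Function.Injective n → ∀ s : Fin K → List A,
    ¬ ∃ a : Fin r → 𝕄, ∀ j, φ.Realize (Sum.elim a (d (ξ ++ n j :: s j)))

/-- The formula saying that `N` instances of `φ` are simultaneously consistent. -/
noncomputable def consFormula (φ : L.Formula (Fin r ⊕ Fin m)) (N : ℕ) :
    L.Formula (Fin N × Fin m) :=
  Formula.iExs (Fin r) (Formula.iInf fun t : Fin N =>
    φ.relabel (Sum.elim (fun i => Sum.inr i) (fun j => Sum.inl (t, j))))

theorem realize_consFormula (φ : L.Formula (Fin r ⊕ Fin m)) (N : ℕ) (y : Fin N × Fin m → 𝕄) :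
    (consFormula φ N).Realize y ↔
      ∃ a : Fin r → 𝕄, ∀ t, φ.Realize (Sum.elim a fun j => y (t, j)) := by
  unfold consFormula
  rw [Formula.realize_iExs]
  refine exists_congr fun a => ?_
  rw [Formula.realize_iInf]
  refine forall_congr' fun t => ?_
  rw [Formula.realize_relabel]
  refine iff_of_eq (congrArg _ (funext fun x => ?_))
  rcases x with i | j <;> rfl

theorem consPath_iff {A : Type} (φ : L.Formula (Fin r ⊕ Fin m)) (d : List A → Fin m → 𝕄) :
    ConsPath φ d ↔ ∀ w : List A,
      (consFormula φ (w.length + 1)).Realize fun q => d (w.take q.1) q.2 := by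
  refine forall_congr' fun w => ?_
  rw [realize_consFormula]
  refine exists_congr fun a => ⟨fun h t => h (w.take t) (List.take_prefix _ _), fun h v hv => ?_⟩
  have := h ⟨v.length, Nat.lt_succ_of_le hv.length_le⟩
  rw [List.prefix_iff_eq_take.1 hv]
  exact this

end PathFan

/-! ### Indiscernible trees -/

section Trees

variable {L : FirstOrder.Language.{u, u}} {𝕄 : Type u} [L.Structure 𝕄] {r m : ℕ}

theorem exists_generic_limit' {I : Type} [LinearOrder I] {κ : Cardinal.{u}}
    (hκ : Cardinal.aleph0 < κ) (hsat : IsSaturated L 𝕄 κ)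
    {α : Type} [Countable α] (G : (I → ℕ) → α → 𝕄) (supp : α → Finset I)
    (hG : ∀ x e e', (∀ i ∈ supp x, e i = e' i) → G e x = G e' x) :
    ∃ c : α → 𝕄,
      (∀ (β : Type) [Finite β] (ψ : L.Formula β) (x : β → α) (S : Finset I),
        (∀ t, supp (x t) ⊆ S) →
        (∀ e : I → ℕ, StrictMonoOn e S → ψ.Realize (G e ∘ x)) → ψ.Realize (c ∘ x)) ∧
      (∀ (β : Type) [Finite β] (ψ : L.Formula β) (x x' : β → α) (g : I → I) (S S' : Finset I),
        StrictMonoOn g S → (∀ i ∈ S, g i ∈ S') →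
        (∀ t, supp (x t) ⊆ S) → (∀ t, supp (x' t) ⊆ S') →
        (∀ e : I → ℕ, StrictMonoOn e S' →
          (ψ.Realize (G (e ∘ g) ∘ x) ↔ ψ.Realize (G e ∘ x'))) →
        (ψ.Realize (c ∘ x) ↔ ψ.Realize (c ∘ x'))) := by
  obtain ⟨c, hc⟩ := exists_generic_limit hκ hsat G supp hG
  have hc' : ∀ (β : Type) [Finite β] (ψ : L.Formula β) (x : β → α) (S : Finset I),
      (∀ t, supp (x t) ⊆ S) →
      (ψ.Realize (c ∘ x) ↔ Gen (S.sort (· ≤ ·)) fun e => ψ.Realize (G e ∘ x)) := by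
    intro β _ ψ x S hS
    obtain ⟨n, ⟨e⟩⟩ := Finite.exists_equiv_fin β
    have := hc n (ψ.relabel e) (x ∘ e.symm) S fun t => hS _
    simp only [Formula.realize_relabel, Function.comp_assoc, Equiv.symm_comp_self,
      Function.comp_id] at this
    exact this
  have hmono : ∀ (S : Finset I) (P : (I → ℕ) → Prop), (∀ e : I → ℕ, StrictMonoOn e S → P e) →
      Gen (S.sort (· ≤ ·)) P := by
    intro S P h
    refine gen_of_lt (Finset.sort_nodup _ _) 0 fun e _ he => h e ?_
    intro a ha b hb hab
    rw [List.pairwise_map] at he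
    rcases (Finset.mem_sort (s := S) (· ≤ ·)).2 ha, (Finset.mem_sort (s := S) (· ≤ ·)).2 hb with ⟨ha, hb⟩
    by_contra hne
    have key := (he.and (Finset.sortedLT_sort S).pairwise)
    obtain ⟨i, hi, rfl⟩ := List.getElem_of_mem ha
    obtain ⟨j, hj, rfl⟩ := List.getElem_of_mem hb
    rcases lt_trichotomy i j with h | h | h
    · exact hne (List.pairwise_iff_getElem.1 key i j hi hj h).1
    · subst h; exact lt_irrefl _ hab
    · exact lt_asymm hab (List.pairwise_iff_getElem.1 key j i hj hi h).2
  refine ⟨c, fun β _ ψ x S hS h => (hc' β ψ x S hS).2 (hmono S _ h), ?_⟩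
  intro β _ ψ x x' g S S' hg hSS' hx hx' h
  rw [hc' β ψ x S hx, hc' β ψ x' S' hx',
    gen_sort_map g (fun i hi j hj hij => hg hi hj hij) (Q := fun e => ψ.Realize (G (e ∘ g) ∘ x)),
    gen_sort_of_subset (Finset.image_subset_iff.2 hSS')]
  · have := hmono S' _ h
    constructor
    · intro h1
      exact (gen_and.2 ⟨this, h1⟩).mono fun e he => he.1.1 he.2
    · intro h1
      exact (gen_and.2 ⟨this, h1⟩).mono fun e he => he.1.2 he.2
  · intro e e' hee
    have : G (e ∘ g) ∘ x = G (e' ∘ g) ∘ x := funext fun t => hG _ _ _ fun i hi =>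
      hee _ (Finset.mem_image_of_mem g (hx t hi))
    rw [this]
  · intro e e' hee
    have : G e ∘ x = G (e' ∘ g) ∘ x := funext fun t => hG _ _ _ fun i hi => hee _ (hx t hi)
    rw [this]

theorem exists_order_indiscernible_tree {I : Type} [LinearOrder I] [Countable I] {κ : Cardinal.{u}}
    (hκ : Cardinal.aleph0 < κ) (hsat : IsSaturated L 𝕄 κ) {K : ℕ}
    (φ : L.Formula (Fin r ⊕ Fin m)) (b : List ℕ → Fin m → 𝕄) (hpath : ConsPath φ b)
    (hfan : IncFan K φ b) :
    ∃ b' : List I → Fin m → 𝕄, ConsPath φ b' ∧ IncFan K φ b' ∧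
      ∀ (β : Type) [Finite β] (ψ : L.Formula β) (x : β → List I) (j : β → Fin m) (f : I → I)
        (S : Finset I), StrictMonoOn f S → (∀ t, ∀ i ∈ x t, i ∈ S) →
        (ψ.Realize (fun t => b' (x t) (j t)) ↔ ψ.Realize (fun t => b' ((x t).map f) (j t))) := by
  obtain ⟨c, hc1, hc2⟩ := exists_generic_limit' hκ hsat (α := List I × Fin m)
    (fun (e : I → ℕ) x => b (x.1.map e) x.2) (fun x => x.1.toFinset) (by
      intro x e e' h
      have : x.1.map e = x.1.map e' := List.map_congr_left fun i hi => h i (by simpa using hi)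
      simp only [this])
  refine ⟨fun v j => c (v, j), ?_, ?_, ?_⟩
  · rw [consPath_iff] at hpath ⊢
    intro w
    refine hc1 _ (consFormula φ (w.length + 1)) (fun q => (w.take q.1, q.2)) w.toFinset ?_ ?_
    · intro t i hi
      simp only [List.mem_toFinset] at hi ⊢
      exact List.mem_of_mem_take hi
    · intro e _
      have := hpath (w.map e)
      rw [realize_consFormula] at this ⊢
      obtain ⟨a, ha⟩ := this
      refine ⟨a, fun t => ?_⟩
      have := ha ⟨t, by simpa using t.2⟩
      simpa [← List.map_take] using this
  · intro ξ n hn s h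
    have h2 := (realize_consFormula φ K (fun q => c (ξ ++ n q.1 :: s q.1, q.2))).2 h
    revert h2
    refine hc1 _ (consFormula φ K).not (fun q => (ξ ++ n q.1 :: s q.1, q.2))
      (Finset.univ.biUnion fun t => (ξ ++ n t :: s t).toFinset) ?_ ?_
    · intro t
      exact Finset.subset_biUnion_of_mem (fun t => (ξ ++ n t :: s t).toFinset) (Finset.mem_univ t.1)
    · intro e he
      rw [Formula.realize_not, realize_consFormula]
      have := hfan (ξ.map e) (e ∘ n) ?_ (fun t => (s t).map e)
      · simpa using this
      · intro t t' htt
        have hmem : ∀ t, n t ∈ ((Finset.univ.biUnion fun t => (ξ ++ n t :: s t).toFinset :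
            Finset I) : Set I) := fun t => by
          simp only [Finset.coe_biUnion, Set.mem_iUnion]
          exact ⟨t, by simp, by simp⟩
        exact hn (he.injOn (hmem t) (hmem t') htt)
  · intro β _ ψ x j f S hf hx
    refine hc2 β ψ (fun t => (x t, j t)) (fun t => ((x t).map f, j t)) f S (S.image f) hf
      (fun i hi => Finset.mem_image_of_mem f hi) ?_ ?_ ?_
    · intro t i hi
      exact hx t i (by simpa using hi)
    · intro t i hi
      simp only [List.mem_toFinset, List.mem_map] at hi
      obtain ⟨i, hi, rfl⟩ := hi
      exact Finset.mem_image_of_mem f (hx t i hi)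
    · intro e _
      refine iff_of_eq (congrArg _ (funext fun t => ?_))
      simp
end Trees

/-! ### Strongly indiscernible trees -/

/-- `u` is the shortest initial segment of `v` with `p < h u`. -/
def IsFirst (h : List ℕ → ℕ) (v : List ℕ) (p : ℕ) (u : List ℕ) : Prop :=
  u <+: v ∧ p < h u ∧ ∀ u₀, u₀ <+: u → u₀ ≠ u → h u₀ ≤ p

theorem exists_isFirst (h : List ℕ → ℕ) (v : List ℕ) (p : ℕ) (hp : p < h v) :
    ∃ u, IsFirst h v p u := by
  induction hn : v.length using Nat.strong_induction_on generalizing v with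
  | _ n ih =>
    by_cases hv : ∃ u₀, u₀ <+: v ∧ u₀ ≠ v ∧ p < h u₀
    · obtain ⟨u₀, h1, h2, h3⟩ := hv
      have hlt : u₀.length < n := by
        subst hn
        exact lt_of_le_of_ne h1.length_le fun h' => h2 (h1.eq_of_length h')
      obtain ⟨u, hu⟩ := ih _ hlt u₀ h3 rfl
      exact ⟨u, hu.1.trans h1, hu.2⟩
    · push Not at hv
      exact ⟨v, List.prefix_rfl, hp, hv⟩

theorem IsFirst.unique {h : List ℕ → ℕ} {v : List ℕ} {p : ℕ} {u u' : List ℕ}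
    (hu : IsFirst h v p u) (hu' : IsFirst h v p u') : u = u' := by
  by_contra hne
  rcases List.prefix_or_prefix_of_prefix hu.1 hu'.1 with h1 | h1
  · exact absurd (hu'.2.2 u h1 hne) (not_le.2 hu.2.1)
  · exact absurd (hu.2.2 u' h1 (Ne.symm hne)) (not_le.2 hu'.2.1)

/-- The shortest initial segment of `v` with `p < h u`, if `p < h v`. -/
noncomputable def firstPrefix (h : List ℕ → ℕ) (v : List ℕ) (p : ℕ) : List ℕ :=
  open Classical in if hp : p < h v then (exists_isFirst h v p hp).choose else []

theorem isFirst_firstPrefix {h : List ℕ → ℕ} {v : List ℕ} {p : ℕ} (hp : p < h v) :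
    IsFirst h v p (firstPrefix h v p) := by
  unfold firstPrefix
  rw [dif_pos hp]
  exact (exists_isFirst h v p hp).choose_spec

theorem IsFirst.eq_firstPrefix {h : List ℕ → ℕ} {v : List ℕ} {p : ℕ} {u : List ℕ} (hp : p < h v)
    (hu : IsFirst h v p u) : firstPrefix h v p = u :=
  (isFirst_firstPrefix hp).unique hu

/-- The branch of length `h v` through the tree of finite sequences of elements of
`List ℕ ×ₗ ℕ`, branching according to the initial segments of `v`. -/
noncomputable def branch (h : List ℕ → ℕ) (v : List ℕ) : List (List ℕ ×ₗ ℕ) :=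
  (List.range (h v)).map fun p => toLex (firstPrefix h v p, p)

theorem branch_congr {h h' : List ℕ → ℕ} {v : List ℕ} (hh : ∀ u, u <+: v → h u = h' u) :
    branch h v = branch h' v := by
  unfold branch
  rw [← hh v List.prefix_rfl]
  refine List.map_congr_left fun p hp => ?_
  have hp' : p < h v := List.mem_range.1 hp
  have h1 := isFirst_firstPrefix hp'
  have h2 : IsFirst h' v p (firstPrefix h v p) :=
    ⟨h1.1, by rw [← hh _ h1.1]; exact h1.2.1, fun u₀ hu₀ hne => by
      rw [← hh _ (hu₀.trans h1.1)]; exact h1.2.2 u₀ hu₀ hne⟩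
  rw [h2.eq_firstPrefix (by rwa [← hh v List.prefix_rfl])]

theorem branch_prefix {h : List ℕ → ℕ} {v w : List ℕ} (hvw : v <+: w) (hle : h v ≤ h w) :
    branch h v <+: branch h w := by
  have h1 : branch h v = (List.range (h v)).map fun p => toLex (firstPrefix h w p, p) := by
    refine List.map_congr_left fun p hp => ?_
    have hp' : p < h v := List.mem_range.1 hp
    have h1 := isFirst_firstPrefix hp'
    rw [IsFirst.eq_firstPrefix (hp'.trans_le hle) ⟨h1.1.trans hvw, h1.2⟩]
  rw [h1]
  refine List.IsPrefix.map _ ?_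
  rw [List.prefix_iff_eq_take, List.take_range]
  simp [hle]

theorem exists_branch_eq {h : List ℕ → ℕ} {ξ : List ℕ} {n : ℕ} {s : List ℕ}
    (hmono : ∀ u v, u <+: v → u ≠ v → v <+: ξ ++ n :: s → h u < h v) :
    ∃ t, branch h (ξ ++ n :: s) = branch h ξ ++ toLex (ξ ++ [n], h ξ) :: t := by
  have hξ : h ξ < h (ξ ++ n :: s) := hmono _ _ (List.prefix_append _ _) (by simp) List.prefix_rfl
  obtain ⟨t, ht⟩ := branch_prefix (List.prefix_append ξ (n :: s)) hξ.le
  have hlen : (branch h ξ).length = h ξ := by simp [branch]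
  cases t with
  | nil =>
    have := congrArg List.length ht
    rw [List.append_nil, hlen] at this
    simp [branch] at this
    omega
  | cons a t =>
    refine ⟨t, ?_⟩
    have h1 : (branch h (ξ ++ n :: s))[h ξ]? = some a := by
      rw [← ht, List.getElem?_append_right hlen.le, hlen]; simp
    have h2 : (branch h (ξ ++ n :: s))[h ξ]? = some (toLex (ξ ++ [n], h ξ)) := by
      have hp : ξ ++ [n] <+: ξ ++ n :: s := ⟨s, by simp⟩
      have : IsFirst h (ξ ++ n :: s) (h ξ) (ξ ++ [n]) := by
        refine ⟨hp, hmono _ _ (List.prefix_append _ _) (by simp) hp, ?_⟩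
        intro u₀ hu₀ hne
        have hu : u₀ <+: ξ := (List.prefix_concat_iff.1 hu₀).resolve_left hne
        rcases eq_or_ne u₀ ξ with rfl | hne'
        · exact le_rfl
        · exact (hmono _ _ hu hne' (List.prefix_append _ _)).le
      rw [branch, List.getElem?_map, List.getElem?_range hξ, Option.map_some,
        this.eq_firstPrefix hξ]
    rw [h1] at h2
    rw [← ht, Option.some.inj h2]

/-- Embeddings of the tree `List ℕ`, preserving initial segments, meets and the order of the
children. -/
structure TreeEmb (g : List ℕ → List ℕ) : Prop where
  mono : ∀ u v, u <+: v → g u <+: g v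
  split : ∀ ξ i i' s s', i < i' → ∃ a a', a < a' ∧ g ξ ++ [a] <+: g (ξ ++ i :: s) ∧
    g ξ ++ [a'] <+: g (ξ ++ i' :: s')

theorem TreeEmb.strictMono {g : List ℕ → List ℕ} (hg : TreeEmb g) : StrictMono g := by
  intro u v huv
  rcases prefix_or_prefix_or_split u v with h | h | ⟨ξ, i, i', s, s', hi, rfl, rfl⟩
  · obtain ⟨t, rfl⟩ := h
    cases t with
    | nil => simp at huv
    | cons i t =>
      obtain ⟨a, a', -, ⟨s, hs⟩, -⟩ := hg.split u i (i + 1) t [] (Nat.lt_succ_self i)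
      rw [← hs]
      simpa using lt_append_cons a (g u) s
  · exact absurd huv (not_lt.2 (le_of_prefix h))
  · rcases lt_or_gt_of_ne hi with hi | hi
    · obtain ⟨a, a', ha, h1, h2⟩ := hg.split ξ i i' s s' hi
      exact lt_of_split ha h1 h2
    · exact absurd huv (not_lt.2 (append_cons_lt_append_cons hi ξ s' s).le)

theorem toLex_lt_of_prefix {w w' : List ℕ} {p p' : ℕ} (h : w <+: w') (hp : p < p') :
    (toLex (w, p) : List ℕ ×ₗ ℕ) < toLex (w', p') := by
  rw [Prod.Lex.toLex_lt_toLex]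
  rcases eq_or_ne w w' with rfl | hne
  · exact Or.inr ⟨rfl, hp⟩
  · exact Or.inl (lt_of_prefix_of_ne h hne)

theorem firstPrefix_comp {g : List ℕ → List ℕ} (hg : TreeEmb g) {h : List ℕ → ℕ} {v : List ℕ}
    {p : ℕ} (hp : p < h (g v)) :
    firstPrefix h (g (firstPrefix (h ∘ g) v p)) p = firstPrefix h (g v) p := by
  have h1 : IsFirst (h ∘ g) v p (firstPrefix (h ∘ g) v p) := isFirst_firstPrefix hp
  set u := firstPrefix (h ∘ g) v p
  have h2 : IsFirst h (g u) p (firstPrefix h (g u) p) := isFirst_firstPrefix h1.2.1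
  exact (IsFirst.eq_firstPrefix hp ⟨h2.1.trans (hg.mono _ _ h1.1), h2.2⟩).symm

/-- The set of pairs occurring in the branches `branch (h ∘ g) v` is mapped to the branches
`branch h (g v)` in a strictly monotone way. -/
theorem strictMonoOn_firstPrefix {g : List ℕ → List ℕ} (hg : TreeEmb g) {h : List ℕ → ℕ}
    {S : Finset (List ℕ)}
    (hmono : ∀ u v w, u <+: v → u ≠ v → v <+: g w → w ∈ S → h u < h v)
    {X : Set (List ℕ ×ₗ ℕ)}
    (hX : ∀ x ∈ X, (ofLex x).1 ∈ S ∧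
      IsFirst (h ∘ g) (ofLex x).1 (ofLex x).2 (ofLex x).1) :
    StrictMonoOn (fun x : List ℕ ×ₗ ℕ =>
      (toLex (firstPrefix h (g (ofLex x).1) (ofLex x).2, (ofLex x).2) : List ℕ ×ₗ ℕ)) X := by
  intro x hx y hy hxy
  obtain ⟨hxS, hx⟩ := hX x hx
  obtain ⟨hyS, hy⟩ := hX y hy
  rcases x with ⟨u, p⟩
  rcases y with ⟨u', p'⟩
  change (toLex (u, p) : List ℕ ×ₗ ℕ) < toLex (u', p') at hxy
  rw [Prod.Lex.toLex_lt_toLex] at hxy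
  change u ∈ S at hxS
  change u' ∈ S at hyS
  change IsFirst (h ∘ g) u p u at hx
  change IsFirst (h ∘ g) u' p' u' at hy
  change (toLex (firstPrefix h (g u) p, p) : List ℕ ×ₗ ℕ) < toLex (firstPrefix h (g u') p', p')
  have hw : IsFirst h (g u) p (firstPrefix h (g u) p) := isFirst_firstPrefix hx.2.1
  have hw' : IsFirst h (g u') p' (firstPrefix h (g u') p') := isFirst_firstPrefix hy.2.1
  set w := firstPrefix h (g u) p
  set w' := firstPrefix h (g u') p'
  -- if `u₀` is a proper initial segment of `u`, then `w` is not an initial segment of `g u₀`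
  have key : ∀ {u p w}, u ∈ S → IsFirst (h ∘ g) u p u → IsFirst h (g u) p w → ∀ u₀, u₀ <+: u →
      u₀ ≠ u → ¬ w <+: g u₀ := by
    intro u p w huS hu hw u₀ h1 h2 h3
    have h4 : h (g u₀) ≤ p := hu.2.2 u₀ h1 h2
    rcases eq_or_ne w (g u₀) with rfl | hne
    · exact absurd hw.2.1 (not_lt.2 h4)
    · have := hmono w (g u₀) u h3 hne (hg.mono _ _ h1) huS
      exact absurd hw.2.1 (not_lt.2 (this.le.trans h4))
  rcases hxy with huu | ⟨rfl, hpp⟩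
  · rw [Prod.Lex.toLex_lt_toLex]
    left
    rcases prefix_or_prefix_or_split u u' with h1 | h1 | ⟨ξ, i, i', s, s', hi, rfl, rfl⟩
    · have h2 := key hyS hy hw' u h1 huu.ne
      rcases List.prefix_or_prefix_of_prefix hw'.1 (hg.mono _ _ h1) with h3 | h3
      · exact absurd h3 h2
      · refine lt_of_prefix_of_ne (hw.1.trans h3) ?_
        intro h4
        have h5 : w = w' := h4
        exact h2 (h5 ▸ hw.1)
    · exact absurd huu (not_lt.2 (le_of_prefix h1))
    · have hi : i < i' := by
        by_contra h'
        exact absurd huu (not_lt.2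
          (append_cons_lt_append_cons (lt_of_le_of_ne (not_lt.1 h') hi.symm) ξ s' s).le)
      obtain ⟨a, a', ha, h1, h2⟩ := hg.split ξ i i' s s' hi
      refine lt_of_split ha ((prefix_cons_or h1 hw.1).resolve_left ?_)
        ((prefix_cons_or h2 hw'.1).resolve_left ?_)
      · exact key hxS hx hw ξ (List.prefix_append _ _) (by simp)
      · exact key hyS hy hw' ξ (List.prefix_append _ _) (by simp)
  · refine toLex_lt_of_prefix ?_ hpp
    rcases List.prefix_or_prefix_of_prefix hw.1 hw'.1 with h3 | h3
    · exact h3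
    · rcases eq_or_ne w' w with h4 | h4
      · rw [h4]
      · exact absurd (hw.2.2 w' h3 h4) (not_le.2 (hpp.trans hw'.2.1))

theorem map_branch {g : List ℕ → List ℕ} (hg : TreeEmb g) (h : List ℕ → ℕ) (v : List ℕ) :
    (branch (h ∘ g) v).map (fun x : List ℕ ×ₗ ℕ =>
      (toLex (firstPrefix h (g (ofLex x).1) (ofLex x).2, (ofLex x).2) : List ℕ ×ₗ ℕ)) =
      branch h (g v) := by
  unfold branch
  rw [List.map_map]
  refine List.map_congr_left fun p hp => ?_
  have := firstPrefix_comp hg (h := h) (v := v) (p := p) (List.mem_range.1 hp)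
  simp only [Function.comp, ofLex_toLex] at this ⊢
  rw [this]

instance : Countable (List ℕ ×ₗ ℕ) := inferInstanceAs (Countable (List ℕ × ℕ))

section Trees

variable {L : FirstOrder.Language.{u, u}} {𝕄 : Type u} [L.Structure 𝕄] {r m : ℕ}

theorem exists_indiscernible_tree {κ : Cardinal.{u}}
    (hκ : Cardinal.aleph0 < κ) (hsat : IsSaturated L 𝕄 κ) {K : ℕ}
    (φ : L.Formula (Fin r ⊕ Fin m)) (b : List ℕ → Fin m → 𝕄) (hpath : ConsPath φ b)
    (hfan : IncFan K φ b) :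
    ∃ c : List ℕ → Fin m → 𝕄, ConsPath φ c ∧ IncFan K φ c ∧
      ∀ g, TreeEmb g → ∀ (β : Type) [Finite β] (ψ : L.Formula β) (x : β → List ℕ) (j : β → Fin m),
        (ψ.Realize (fun t => c (x t) (j t)) ↔ ψ.Realize (fun t => c (g (x t)) (j t))) := by
  obtain ⟨b', hpath', hfan', hb'⟩ := exists_order_indiscernible_tree (I := List ℕ ×ₗ ℕ) hκ hsat
    φ b hpath hfan
  obtain ⟨c, hc1, hc2⟩ := exists_generic_limit' hκ hsat (α := List ℕ × Fin m)
    (fun h x => b' (branch h x.1) x.2) (fun x => x.1.inits.toFinset) (by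
      intro x e e' h
      have : branch e x.1 = branch e' x.1 := branch_congr fun u hu => h u (by simpa using hu)
      simp only [this])
  have hsm : ∀ {S : Finset (List ℕ)} {h : List ℕ → ℕ}, StrictMonoOn h S →
      ∀ v w, v ∈ S → w ∈ S → v <+: w → h v ≤ h w := by
    intro S h hS v w hv hw hvw
    exact hS.monotoneOn hv hw (le_of_prefix hvw)
  refine ⟨fun v j => c (v, j), ?_, ?_, ?_⟩
  · rw [consPath_iff]
    intro w
    refine hc1 _ (consFormula φ (w.length + 1)) (fun q => (w.take q.1, q.2)) w.inits.toFinset ?_ ?_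
    · intro t i hi
      simp only [List.mem_toFinset, List.mem_inits] at hi ⊢
      exact hi.trans (List.take_prefix _ _)
    · intro e he
      rw [realize_consFormula]
      obtain ⟨a, ha⟩ := hpath' (branch e w)
      refine ⟨a, fun t => ha (branch e (w.take t)) (branch_prefix (List.take_prefix _ _) (hsm he _ _ ?_ ?_
        (List.take_prefix _ _)))⟩
      · simpa using List.take_prefix _ _
      · simp
  · intro ξ n hn s h
    have h2 := (realize_consFormula φ K (fun q => c (ξ ++ n q.1 :: s q.1, q.2))).2 h
    revert h2
    refine hc1 _ (consFormula φ K).not (fun q => (ξ ++ n q.1 :: s q.1, q.2))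
      (Finset.univ.biUnion fun t => (ξ ++ n t :: s t).inits.toFinset) ?_ ?_
    · intro t
      exact Finset.subset_biUnion_of_mem (fun t => (ξ ++ n t :: s t).inits.toFinset)
        (Finset.mem_univ t.1)
    · intro e he
      rw [Formula.realize_not, realize_consFormula]
      have hbr : ∀ t, ∃ z, branch e (ξ ++ n t :: s t) =
          branch e ξ ++ toLex (ξ ++ [n t], e ξ) :: z := by
        intro t
        have hmem : ∀ u, u <+: ξ ++ n t :: s t →
            u ∈ (Finset.univ.biUnion fun t => (ξ ++ n t :: s t).inits.toFinset) := by
          intro u hu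
          rw [Finset.mem_biUnion]
          exact ⟨t, Finset.mem_univ t, List.mem_toFinset.2 ((List.mem_inits _ _).2 hu)⟩
        refine exists_branch_eq fun u v huv hne hv =>
          he (hmem u (huv.trans hv)) (hmem v hv) (lt_of_prefix_of_ne huv hne)
      choose z hz using hbr
      have := hfan' (branch e ξ) (fun t => toLex (ξ ++ [n t], e ξ)) ?_ z
      · simpa [hz] using this
      · intro t t' htt
        refine hn ?_
        have := congrArg (fun y => (ofLex y).1) htt
        simpa using this
  · intro g hg β _ ψ x j
    have := Fintype.ofFinite β
    set S : Finset (List ℕ) := Finset.univ.biUnion fun t : β => (x t).inits.toFinset with hSdef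
    set S' : Finset (List ℕ) := Finset.univ.biUnion fun t : β => (g (x t)).inits.toFinset with hSdef'
    have hS : ∀ u, u ∈ S ↔ ∃ t, u <+: x t := fun u => by simp [hSdef]
    have hS' : ∀ u, u ∈ S' ↔ ∃ t, u <+: g (x t) := fun u => by simp [hSdef']
    refine hc2 β ψ (fun t => (x t, j t)) (fun t => (g (x t), j t)) g S S'
      (hg.strictMono.strictMonoOn _) ?_ ?_ ?_ ?_
    · intro v hv
      obtain ⟨t, ht⟩ := (hS v).1 hv
      exact (hS' _).2 ⟨t, hg.mono _ _ ht⟩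
    · intro t
      exact Finset.subset_biUnion_of_mem (fun t => (x t).inits.toFinset) (Finset.mem_univ t)
    · intro t
      exact Finset.subset_biUnion_of_mem (fun t => (g (x t)).inits.toFinset) (Finset.mem_univ t)
    · intro h hh
      have key := hb' β ψ (fun t => branch (h ∘ g) (x t)) j _
        (Finset.univ.biUnion fun t => (branch (h ∘ g) (x t)).toFinset)
        (strictMonoOn_firstPrefix hg (h := h) (S := S) ?_ ?_) ?_
      · simp only [map_branch hg] at key
        exact key
      · intro u v w huv hne hv hw
        obtain ⟨t, ht⟩ := (hS w).1 hw
        have h1 : v ∈ S' := (hS' v).2 ⟨t, hv.trans (hg.mono _ _ ht)⟩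
        have h2 : u ∈ S' := (hS' u).2 ⟨t, huv.trans (hv.trans (hg.mono _ _ ht))⟩
        exact hh h2 h1 (lt_of_prefix_of_ne huv hne)
      · intro y hy
        simp only [branch, Finset.coe_biUnion, Set.mem_iUnion, List.coe_toFinset, List.mem_map,
          Set.mem_ofPred_eq, List.mem_range] at hy
        obtain ⟨t, -, p, hp, rfl⟩ := hy
        have h1 := isFirst_firstPrefix (h := h ∘ g) hp
        exact ⟨(hS _).2 ⟨t, h1.1⟩, List.prefix_rfl, h1.2⟩
      · intro t i hi
        rw [Finset.mem_biUnion]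
        exact ⟨t, Finset.mem_univ t, by simpa using hi⟩

theorem exists_fin_formula {α : Type w} (ψ : L.Formula α) :
    ∃ (n : ℕ) (ψ' : L.Formula (Fin n)) (z : Fin n → α), Function.Injective z ∧
      ∀ v : α → 𝕄, ψ.Realize v ↔ ψ'.Realize (v ∘ z) := by
  classical
  obtain ⟨n, ⟨e⟩⟩ := Finite.exists_equiv_fin (BoundedFormula.freeVarFinset ψ)
  refine ⟨n, BoundedFormula.restrictFreeVar ψ e, fun i => (e.symm i).1,
    Subtype.val_injective.comp e.symm.injective, fun v => ?_⟩
  unfold Formula.Realize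
  rw [BoundedFormula.realize_restrictFreeVar (v' := v)]
  intro a
  simp

/-- Embeddings of the tree extend to automorphisms of the monster model. -/
theorem exists_equiv_of_treeEmb {κ : Cardinal.{u}} (hκ : Cardinal.aleph0 < κ)
    (hhom : IsStronglyHomogeneous L 𝕄 κ) {c : List ℕ → Fin m → 𝕄}
    (hc : ∀ g, TreeEmb g → ∀ (β : Type) [Finite β] (ψ : L.Formula β) (x : β → List ℕ)
      (j : β → Fin m),
        (ψ.Realize (fun t => c (x t) (j t)) ↔ ψ.Realize (fun t => c (g (x t)) (j t))))
    {g : List ℕ → List ℕ} (hg : TreeEmb g) :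
    ∃ σ : 𝕄 ≃[L] 𝕄, ∀ v j, σ (c v j) = c (g v) j := by
  classical
  obtain ⟨σ, hσ⟩ := hhom (ULift.{u} (List ℕ × Fin m)) (lt_of_le_of_lt Cardinal.mk_le_aleph0 hκ)
    (fun x => c x.down.1 x.down.2) (fun x => c (g x.down.1) x.down.2) (by
      intro n ψ p hp
      have hn : n = 0 := by
        rcases Nat.eq_zero_or_pos n with h | h
        · exact h
        · exact (hp ⟨0, h⟩).elim
      subst hn
      obtain ⟨N, ψ', z, -, hψ'⟩ := exists_fin_formula (𝕄 := 𝕄)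
        (ψ.relabel (Sum.elim id Fin.elim0 : ULift.{u} (List ℕ × Fin m) ⊕ Fin 0 → _))
      have h1 : ∀ v : ULift.{u} (List ℕ × Fin m) → 𝕄,
          ψ.Realize (Sum.elim v p) ↔ ψ'.Realize (v ∘ z) := by
        intro v
        rw [← hψ', Formula.realize_relabel]
        refine iff_of_eq (congrArg _ (funext fun x => ?_))
        rcases x with x | i
        · rfl
        · exact i.elim0
      rw [h1, h1]
      exact hc g hg (Fin N) ψ' (fun t => (z t).down.1) (fun t => (z t).down.2))
  exact ⟨σ, fun v j => hσ ⟨(v, j)⟩⟩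

end Trees

/-! ### Grafting -/

/-- The embedding of the tree `List ℕ` that moves the node `a` to `a ++ X`, and the part of the tree
above the child `a ++ [i]` to the part above `a ++ X ++ α i :: W i`. -/
def graft (a X : List ℕ) (α : ℕ → ℕ) (W : ℕ → List ℕ) (v : List ℕ) : List ℕ :=
  if a <+: v then
    match v.drop a.length with
    | [] => a ++ X
    | i :: w => a ++ X ++ α i :: (W i ++ w)
  else v

section Graft

variable (a X : List ℕ) (α : ℕ → ℕ) (W : ℕ → List ℕ)

theorem graft_self : graft a X α W a = a ++ X := by
  simp [graft]

theorem graft_append_cons (i : ℕ) (w : List ℕ) :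
    graft a X α W (a ++ i :: w) = a ++ X ++ α i :: (W i ++ w) := by
  simp [graft]

theorem graft_of_not_prefix {v : List ℕ} (h : ¬ a <+: v) : graft a X α W v = v := by
  simp [graft, h]

theorem prefix_graft {v : List ℕ} (h : a <+: v) : a <+: graft a X α W v := by
  obtain ⟨t, rfl⟩ := h
  cases t with
  | nil => rw [List.append_nil, graft_self]; exact List.prefix_append _ _
  | cons i t => rw [graft_append_cons, List.append_assoc]; exact List.prefix_append _ _

variable {α}

theorem treeEmb_graft (hα : StrictMono α) : TreeEmb (graft a X α W) := by
  constructor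
  · intro u v huv
    by_cases hu : a <+: u
    · obtain ⟨x, rfl⟩ := hu
      obtain ⟨t, rfl⟩ := huv
      cases x with
      | nil =>
        rw [List.append_nil, graft_self]
        cases t with
        | nil => rw [List.append_nil, graft_self]
        | cons i t => rw [graft_append_cons]; exact List.prefix_append _ _
      | cons i x =>
        rw [List.append_assoc, List.cons_append, graft_append_cons, graft_append_cons]
        exact ⟨t, by simp⟩
    · rw [graft_of_not_prefix _ _ _ _ hu]
      by_cases hv : a <+: v
      · exact ((List.prefix_or_prefix_of_prefix huv hv).resolve_right hu).trans
          (prefix_graft _ _ _ _ hv)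
      · rwa [graft_of_not_prefix _ _ _ _ hv]
  · intro ξ i i' s s' hi
    by_cases hξ : a <+: ξ
    · obtain ⟨x, rfl⟩ := hξ
      cases x with
      | nil =>
        refine ⟨α i, α i', hα hi, ?_, ?_⟩
        · rw [List.append_nil, graft_self, graft_append_cons]
          exact ⟨W i ++ s, by simp⟩
        · rw [List.append_nil, graft_self, graft_append_cons]
          exact ⟨W i' ++ s', by simp⟩
      | cons j x =>
        refine ⟨i, i', hi, ?_, ?_⟩
        · rw [List.append_assoc, List.cons_append, graft_append_cons, graft_append_cons]
          exact ⟨s, by simp⟩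
        · rw [List.append_assoc, List.cons_append, graft_append_cons, graft_append_cons]
          exact ⟨s', by simp⟩
    · have key : ∀ i s, graft a X α W ξ ++ [i] <+: graft a X α W (ξ ++ i :: s) := by
        intro i s
        have h1 : ξ ++ [i] <+: ξ ++ i :: s := ⟨s, by simp⟩
        rw [graft_of_not_prefix _ _ _ _ hξ]
        by_cases hv : a <+: ξ ++ i :: s
        · exact ((prefix_cons_or h1 hv).resolve_left hξ).trans (prefix_graft _ _ _ _ hv)
        · rwa [graft_of_not_prefix _ _ _ _ hv]
      exact ⟨i, i', hi, key i s, key i' s'⟩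

end Graft

/-! ### Incomparable sequences -/

/-- Neither of the two sequences is an initial segment of the other one. -/
def Incomp {A : Type w} (u v : List A) : Prop := ¬ u <+: v ∧ ¬ v <+: u

theorem Incomp.symm {A : Type w} {u v : List A} (h : Incomp u v) : Incomp v u := ⟨h.2, h.1⟩

theorem Incomp.append {A : Type w} {u v : List A} (h : Incomp u v) (s t : List A) :
    Incomp (u ++ s) (v ++ t) := by
  constructor
  · intro h'
    rcases List.prefix_or_prefix_of_prefix ((List.prefix_append u s).trans h')
      (List.prefix_append v t) with h1 | h1
    · exact h.1 h1
    · exact h.2 h1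
  · intro h'
    rcases List.prefix_or_prefix_of_prefix ((List.prefix_append v t).trans h')
      (List.prefix_append u s) with h1 | h1
    · exact h.2 h1
    · exact h.1 h1

theorem Incomp.append_right {A : Type w} {u v : List A} (h : Incomp u v) (t : List A) :
    Incomp u (v ++ t) := by
  simpa using h.append [] t

theorem Incomp.append_left {A : Type w} {u v : List A} (h : Incomp u v) (t : List A) :
    Incomp (u ++ t) v := by
  simpa using h.append t []

theorem incomp_append_iff {A : Type w} {a u v : List A} : Incomp (a ++ u) (a ++ v) ↔ Incomp u v := by
  simp [Incomp, List.prefix_append_right_inj]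

theorem incomp_cons {A : Type w} {i j : A} (h : i ≠ j) (u v : List A) :
    Incomp (i :: u) (j :: v) := by
  simp [Incomp, h, h.symm]

theorem incomp_cons_iff {A : Type w} {i : A} {u v : List A} :
    Incomp (i :: u) (i :: v) ↔ Incomp u v := by
  simp [Incomp]

theorem Incomp.exists_split {A : Type w} {u v : List A} (h : Incomp u v) :
    ∃ ξ i i' s s', i ≠ i' ∧ u = ξ ++ i :: s ∧ v = ξ ++ i' :: s' :=
  ((prefix_or_prefix_or_split u v).resolve_left h.1).resolve_left h.2

theorem meet_append_cons {A : Type w} [DecidableEq A] {i i' : A} (h : i ≠ i') (ξ s s' : List A) :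
    meet (ξ ++ i :: s) (ξ ++ i' :: s') = ξ := by
  induction ξ with
  | nil => simp [meet, h]
  | cons a ξ ih => simp [meet, ih]

theorem exists_fan_of_meet_eq {A : Type w} [DecidableEq A] {k : ℕ} (hk : 2 ≤ k)
    {η : Fin k → List A} (hη : ∀ i j, i ≠ j → ¬ η i <+: η j)
    (hmeet : ∀ i j i' j' : Fin k, i ≠ j → i' ≠ j' → meet (η i) (η j) = meet (η i') (η j')) :
    ∃ (ξ : List A) (n : Fin k → A) (s : Fin k → List A), Function.Injective n ∧
      ∀ j, η j = ξ ++ n j :: s j := by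
  let i₀ : Fin k := ⟨0, by omega⟩
  let i₁ : Fin k := ⟨1, by omega⟩
  have h01 : i₀ ≠ i₁ := by simp [i₀, i₁]
  have key : ∀ i j, i ≠ j → ∃ a b s t, a ≠ b ∧ η i = meet (η i₀) (η i₁) ++ a :: s ∧
      η j = meet (η i₀) (η i₁) ++ b :: t := by
    intro i j hij
    obtain ⟨ξ, a, b, s, t, hab, h1, h2⟩ :=
      Incomp.exists_split ⟨hη i j hij, hη j i hij.symm⟩
    have h3 : meet (η i₀) (η i₁) = ξ := by
      rw [hmeet i₀ i₁ i j h01 hij, h1, h2, meet_append_cons hab]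
    exact ⟨a, b, s, t, hab, by rw [h3]; exact h1, by rw [h3]; exact h2⟩
  have key2 : ∀ i, ∃ a s, η i = meet (η i₀) (η i₁) ++ a :: s := by
    intro i
    by_cases hi : i = i₀
    · obtain ⟨a, b, s, t, -, h1, -⟩ := key i i₁ (hi ▸ h01)
      exact ⟨a, s, h1⟩
    · obtain ⟨a, b, s, t, -, h1, -⟩ := key i i₀ hi
      exact ⟨a, s, h1⟩
  choose n s hns using key2
  refine ⟨_, n, s, ?_, hns⟩
  intro i j hij
  by_contra hne
  obtain ⟨a, b, s', t', hab, h1, h2⟩ := key i j hne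
  rw [hns i] at h1
  rw [hns j] at h2
  have h3 := List.append_cancel_left h1
  have h4 := List.append_cancel_left h2
  rw [List.cons.injEq] at h3 h4
  exact hab (h3.1.symm.trans (hij.trans h4.1))

theorem meet_append_cons_of_fan {k : ℕ} {A : Type w} [DecidableEq A] {n : Fin k → A}
    (hn : Function.Injective n) (ξ : List A) (s : Fin k → List A) :
    (∀ i j, i ≠ j → ¬ ξ ++ n i :: s i <+: ξ ++ n j :: s j) ∧
    ∀ i j i' j' : Fin k, i ≠ j → i' ≠ j' → meet (ξ ++ n i :: s i) (ξ ++ n j :: s j) =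
      meet (ξ ++ n i' :: s i') (ξ ++ n j' :: s j') := by
  constructor
  · intro i j hij
    exact (incomp_append_iff.2 (incomp_cons (hn.ne hij) _ _)).1
  · intro i j i' j' hij hij'
    rw [meet_append_cons (hn.ne hij), meet_append_cons (hn.ne hij')]

/-! ### Uniformly definable families -/

section UnifDef

variable {L : FirstOrder.Language.{u, u}} {𝕄 : Type u} [L.Structure 𝕄] {γ : Type}

/-- The sets `D i` are defined by instances of one formula. -/
def UnifDef (L : FirstOrder.Language.{u, u}) {𝕄 : Type u} [L.Structure 𝕄] {γ : Type} {ι : Type w}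
    (D : ι → Set (γ → 𝕄)) : Prop :=
  ∃ (δ : Type) (_ : Finite δ) (R : L.Formula (γ ⊕ δ)) (b : ι → δ → 𝕄),
    ∀ i v, v ∈ D i ↔ R.Realize (Sum.elim v (b i))

theorem UnifDef.comp {ι : Type w} {ι' : Type v} {D : ι → Set (γ → 𝕄)} (h : UnifDef L D)
    (f : ι' → ι) : UnifDef L (fun i => D (f i)) := by
  obtain ⟨δ, hδ, R, b, hb⟩ := h
  exact ⟨δ, hδ, R, fun i => b (f i), fun i v => hb _ _⟩

theorem UnifDef.forall {κ : Type} [Finite κ] {ι : Type w} {D : κ → ι → Set (γ → 𝕄)}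
    (h : ∀ t, UnifDef L (D t)) : UnifDef L (fun i => {v | ∀ t, v ∈ D t i}) := by
  choose δ hδ R b hb using h
  refine ⟨Σ t, δ t, inferInstance,
    Formula.iInf fun t => (R t).relabel (Sum.map id fun d => ⟨t, d⟩),
    fun i d => b d.1 i d.2, fun i v => ?_⟩
  rw [Formula.realize_iInf]
  refine forall_congr' fun t => ?_
  rw [Formula.realize_relabel, hb, Sum.elim_comp_map]
  rfl

theorem UnifDef.inter {ι : Type w} {D E : ι → Set (γ → 𝕄)} (hD : UnifDef L D)
    (hE : UnifDef L E) : UnifDef L (fun i => D i ∩ E i) := by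
  have := UnifDef.forall (L := L) (κ := Bool) (D := fun t i => if t then D i else E i)
    (by intro t; cases t <;> simpa)
  convert this using 2 with i
  ext v
  simp [and_comm]

theorem unifDef_univ {ι : Type w} : UnifDef L (fun _ : ι => (Set.univ : Set (γ → 𝕄))) :=
  ⟨Empty, inferInstance, ⊤, fun _ => Empty.elim, fun i v => by simp [Formula.Realize]⟩

theorem UnifDef.forall_finite {κ : Type} {s : Set κ} (hs : s.Finite) {ι : Type w}
    {D : κ → ι → Set (γ → 𝕄)} (h : ∀ t ∈ s, UnifDef L (D t)) :
    UnifDef L (fun i => {v | ∀ t ∈ s, v ∈ D t i}) := by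
  have : Finite s := hs
  have := UnifDef.forall (L := L) (κ := s) (D := fun t => D t.1) fun t => h t.1 t.2
  convert this using 2 with i
  ext v
  simp

theorem unifDef_realize {ι : Type w} {r m : ℕ} (φ : L.Formula (Fin r ⊕ Fin m)) (sel : Fin r → γ)
    (b : ι → Fin m → 𝕄) :
    UnifDef L (fun i => {v : γ → 𝕄 | φ.Realize (Sum.elim (v ∘ sel) (b i))}) := by
  refine ⟨Fin m, inferInstance, φ.relabel (Sum.map sel id), b, fun i v => ?_⟩
  rw [Formula.realize_relabel, Sum.elim_comp_map]
  rfl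

theorem unifDef_realize_self {ι : Type w} {r m : ℕ} (φ : L.Formula (Fin r ⊕ Fin m))
    (sel : Fin r → γ) (sel' : Fin m → γ) :
    UnifDef L (fun _ : ι => {v : γ → 𝕄 | φ.Realize (Sum.elim (v ∘ sel) (v ∘ sel'))}) := by
  refine ⟨Empty, inferInstance, φ.relabel (Sum.elim (Sum.inl ∘ sel) (Sum.inl ∘ sel')),
    fun _ => Empty.elim, fun i v => ?_⟩
  rw [Formula.realize_relabel]
  change φ.Realize (Sum.elim (v ∘ sel) (v ∘ sel')) ↔ _
  refine iff_of_eq (congrArg _ (funext fun x => ?_))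
  rcases x with x | x <;> rfl

/-- `φ(x, y)` is inconsistent with the formulas `φ(x, p j)`. -/
def Kills {r m k : ℕ} (φ : L.Formula (Fin r ⊕ Fin m)) (y : Fin m → 𝕄) (p : Fin k → Fin m → 𝕄) :
    Prop :=
  ¬ ∃ x : Fin r → 𝕄, φ.Realize (Sum.elim x y) ∧ ∀ j, φ.Realize (Sum.elim x (p j))

theorem unifDef_kills {ι : Type w} {r m k : ℕ} (φ : L.Formula (Fin r ⊕ Fin m)) (sel : Fin m → γ)
    (p : ι → Fin k → Fin m → 𝕄) :
    UnifDef L (fun i => {v : γ → 𝕄 | Kills φ (v ∘ sel) (p i)}) := by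
  refine ⟨Fin k × Fin m, inferInstance, ((consFormula φ (k + 1)).relabel fun q =>
    Fin.cases (Sum.inl (sel q.2)) (fun t => Sum.inr (t, q.2)) q.1).not,
    fun i q => p i q.1 q.2, fun i v => ?_⟩
  rw [Formula.realize_not, Formula.realize_relabel, realize_consFormula]
  refine not_congr (exists_congr fun x => ?_)
  rw [Fin.forall_fin_succ]
  rfl

/-- A uniformly definable tree with consistent paths is given by a formula in finitely many
variables. -/
theorem UnifDef.exists_tree {κ : Cardinal.{u}} (hκ : Cardinal.aleph0 < κ)
    (hsat : IsSaturated L 𝕄 κ) {A : Type} {D : List A → Set (γ → 𝕄)} (hD : UnifDef L D)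
    (hpath : ∀ w, ∃ x, ∀ v, v <+: w → x ∈ D v) :
    ∃ (r m : ℕ) (φ : L.Formula (Fin r ⊕ Fin m)) (b : List A → Fin m → 𝕄),
      (∀ σ : ℕ → A, ∃ a : Fin r → 𝕄,
        ∀ n : ℕ, φ.Realize (Sum.elim a (b (List.ofFn fun i : Fin n => σ i)))) ∧
      ∀ s : Set (List A), (∃ a : Fin r → 𝕄, ∀ v ∈ s, φ.Realize (Sum.elim a (b v))) →
        ∃ x, ∀ v ∈ s, x ∈ D v := by
  classical
  obtain ⟨δ, -, R, b, hb⟩ := hD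
  obtain ⟨n, R', z, hz, hR'⟩ := exists_fin_formula (𝕄 := 𝕄) R
  obtain ⟨x₀, -⟩ := hpath []
  let φ : L.Formula (Fin n ⊕ Fin n) :=
    R'.relabel fun t => if (z t).isLeft then Sum.inl t else Sum.inr t
  let d : List A → Fin n → 𝕄 := fun v t => Sum.elim x₀ (b v) (z t)
  have hφ : ∀ (a : Fin n → 𝕄) v (x : γ → 𝕄), (∀ t g, z t = Sum.inl g → a t = x g) →
      (φ.Realize (Sum.elim a (d v)) ↔ x ∈ D v) := by
    intro a v x hax
    rw [hb, hR', Formula.realize_relabel]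
    refine iff_of_eq (congrArg _ (funext fun t => ?_))
    rcases hzt : z t with g | e
    · simp [hzt, hax t g hzt]
    · simp [hzt, d]
  refine ⟨n, n, φ, d, ?_, ?_⟩
  · intro σ
    refine hsat.realize_of_finite hκ (fun _ : ℕ => n) (fun _ => φ)
      (fun i => d (List.ofFn fun j : Fin i => σ j)) ?_ ?_
    · exact Set.countable_iUnion fun i => Set.countable_range _
    · intro s
      obtain ⟨x, hx⟩ := hpath (List.ofFn fun j : Fin (s.sup id) => σ j)
      refine ⟨fun t => Sum.elim x (b []) (z t), fun i hi => ?_⟩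
      refine (hφ _ _ x ?_).2 (hx _ ?_)
      · intro t g h
        simp [h]
      · have hle : i ≤ s.sup id := Finset.le_sup (f := id) hi
        rw [List.prefix_iff_eq_take]
        apply List.ext_getElem
        · simp [hle]
        · simp
  · rintro s ⟨a, ha⟩
    refine ⟨fun g => if h : ∃ t, z t = Sum.inl g then a h.choose else x₀ g, fun v hv => ?_⟩
    refine (hφ a v _ ?_).1 (ha v hv)
    intro t g h
    have hex : ∃ t, z t = Sum.inl g := ⟨t, h⟩
    have h1 : hex.choose = t := hz (hex.choose_spec.trans h.symm)
    rw [dif_pos hex, h1]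

theorem UnifDef.hasSOP2 {κ : Cardinal.{u}} (hκ : Cardinal.aleph0 < κ)
    (hsat : IsSaturated L 𝕄 κ) {D : List Bool → Set (γ → 𝕄)} (hD : UnifDef L D)
    (hpath : ∀ w, ∃ x, ∀ v, v <+: w → x ∈ D v)
    (hinc : ∀ ξ s s', ¬ ∃ x, x ∈ D (ξ ++ false :: s) ∧ x ∈ D (ξ ++ true :: s')) :
    HasSOP2 L 𝕄 := by
  obtain ⟨r, m, φ, b, h1, h2⟩ := hD.exists_tree hκ hsat hpath
  refine ⟨r, m, φ, b, h1, ?_⟩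
  rintro η₁ η₂ h12 h21 ⟨a, ha1, ha2⟩
  obtain ⟨x, hx⟩ := h2 {η₁, η₂} ⟨a, by simp [ha1, ha2]⟩
  have hx1 := hx η₁ (by simp)
  have hx2 := hx η₂ (by simp)
  obtain ⟨ξ, i, i', s, s', hi, rfl, rfl⟩ := Incomp.exists_split ⟨h12, h21⟩
  cases i <;> cases i'
  · exact hi rfl
  · exact hinc ξ s s' ⟨x, hx1, hx2⟩
  · exact hinc ξ s' s ⟨x, hx2, hx1⟩
  · exact hi rfl

theorem UnifDef.hasWeakKTP1 {κ : Cardinal.{u}} (hκ : Cardinal.aleph0 < κ)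
    (hsat : IsSaturated L 𝕄 κ) {k : ℕ} (hk : 2 ≤ k) {D : List ℕ → Set (γ → 𝕄)} (hD : UnifDef L D)
    (hpath : ∀ w, ∃ x, ∀ v, v <+: w → x ∈ D v)
    (hinc : ∀ ξ (n : Fin k → ℕ), StrictMono n → ∀ s : Fin k → List ℕ,
      ¬ ∃ x, ∀ j, x ∈ D (ξ ++ n j :: s j)) :
    HasWeakKTP1 L 𝕄 k := by
  obtain ⟨r, m, φ, b, h1, h2⟩ := hD.exists_tree hκ hsat hpath
  refine ⟨r, m, φ, b, h1, ?_⟩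
  rintro η hη hmeet ⟨a, ha⟩
  obtain ⟨x, hx⟩ := h2 (Set.range η) ⟨a, by rintro _ ⟨j, rfl⟩; exact ha j⟩
  obtain ⟨ξ, n, s, hn, hns⟩ := exists_fan_of_meet_eq hk hη hmeet
  have hsort : StrictMono (n ∘ Tuple.sort n) :=
    (Tuple.monotone_sort n).strictMono_of_injective (hn.comp (Tuple.sort n).injective)
  refine hinc ξ (n ∘ Tuple.sort n) hsort (s ∘ Tuple.sort n) ⟨x, fun j => ?_⟩
  have := hx _ ⟨Tuple.sort n j, rfl⟩
  rwa [hns] at this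

/-- By compactness, finite trees of every height witness `SOP₂`. -/
theorem hasSOP2_of_finite_trees {κ : Cardinal.{u}} (hκ : Cardinal.aleph0 < κ)
    (hsat : IsSaturated L 𝕄 κ) {r q : ℕ} (χ : L.Formula (Fin r ⊕ Fin q))
    (h : ∀ M : ℕ, ∃ d : List Bool → Fin q → 𝕄,
      (∀ w, w.length < M → ∃ a : Fin r → 𝕄, ∀ v, v <+: w → χ.Realize (Sum.elim a (d v))) ∧
      ∀ ξ s s', (ξ ++ false :: s).length < M → (ξ ++ true :: s').length < M →
        ¬ ∃ a : Fin r → 𝕄, χ.Realize (Sum.elim a (d (ξ ++ false :: s))) ∧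
          χ.Realize (Sum.elim a (d (ξ ++ true :: s')))) :
    HasSOP2 L 𝕄 := by
  classical
  obtain ⟨d, hd⟩ := hsat.realize_of_finite hκ (α := List Bool × Fin q)
    (ι := List Bool ⊕ (List Bool × List Bool × List Bool)) (fun _ => 0)
    (Sum.elim
      (fun w => (consFormula χ (w.length + 1)).relabel fun t : Fin (w.length + 1) × Fin q =>
        (Sum.inl (w.take t.1, t.2) : (List Bool × Fin q) ⊕ Fin 0))
      (fun p => ((consFormula χ 2).relabel fun t : Fin 2 × Fin q =>
        (Sum.inl ((if t.1 = 0 then p.1 ++ false :: p.2.1 else p.1 ++ true :: p.2.2), t.2) :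
          (List Bool × Fin q) ⊕ Fin 0)).not))
    (fun _ => Fin.elim0) (by
      rw [show (⋃ _, Set.range (Fin.elim0 : Fin 0 → 𝕄)) = ∅ by simp]
      exact Set.countable_empty) (by
      intro s
      obtain ⟨d, hd1, hd2⟩ := h ((s.sup (Sum.elim (fun w => w.length) (fun p =>
        (p.1 ++ false :: p.2.1).length + (p.1 ++ true :: p.2.2).length))) + 1)
      refine ⟨fun t => d t.1 t.2, fun i hi => ?_⟩
      have hle := Finset.le_sup (f := (Sum.elim (fun w : List Bool => w.length)
        (fun p : List Bool × List Bool × List Bool =>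
          (p.1 ++ false :: p.2.1).length + (p.1 ++ true :: p.2.2).length))) hi
      rcases i with w | ⟨ξ, s, s'⟩
      · simp only [Sum.elim_inl] at hle ⊢
        rw [Formula.realize_relabel, realize_consFormula]
        obtain ⟨a, ha⟩ := hd1 w (Nat.lt_succ_of_le hle)
        exact ⟨a, fun t => ha (w.take t) (List.take_prefix _ _)⟩
      · simp only [Sum.elim_inr] at hle ⊢
        rw [Formula.realize_not, Formula.realize_relabel, realize_consFormula]
        rintro ⟨a, ha⟩
        exact hd2 ξ s s' (by omega) (by omega) ⟨a, ha 0, ha 1⟩)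
  refine UnifDef.hasSOP2 hκ hsat (D := fun v => {a | χ.Realize (Sum.elim (a ∘ id) fun j => d (v, j))})
    (unifDef_realize χ id _) ?_ ?_
  · have : ConsPath χ fun v j => d (v, j) := by
      rw [consPath_iff]
      intro w
      have := hd (Sum.inl w)
      simp only [Sum.elim_inl] at this
      rwa [Formula.realize_relabel] at this
    exact this
  · rintro ξ s s' ⟨a, ha1, ha2⟩
    have := hd (Sum.inr (ξ, s, s'))
    simp only [Sum.elim_inr] at this
    rw [Formula.realize_not, Formula.realize_relabel, realize_consFormula] at this
    apply this
    refine ⟨a, fun t => ?_⟩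
    fin_cases t
    · exact ha1
    · exact ha2

end UnifDef

/-! ### Moving definable sets along tree embeddings -/

section Move

variable {L : FirstOrder.Language.{u, u}} {𝕄 : Type u} [L.Structure 𝕄] {m : ℕ} {γ : Type}

/-- The automorphism `σ` moves the tree `c` along `g`. -/
def Moves (c : List ℕ → Fin m → 𝕄) (σ : 𝕄 ≃[L] 𝕄) (g : List ℕ → List ℕ) : Prop :=
  ∀ v j, σ (c v j) = c (g v) j

/-- Every tree embedding acts on the tree `c` by an automorphism. -/
def TreeHomogeneous (L : FirstOrder.Language.{u, u}) {𝕄 : Type u} [L.Structure 𝕄]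
    (c : List ℕ → Fin m → 𝕄) : Prop :=
  ∀ g, TreeEmb g → ∃ σ : 𝕄 ≃[L] 𝕄, Moves c σ g

/-- The map `g` acts as a translation on the part of the tree above the positive children of
`u`. -/
def GoodAt (g : List ℕ → List ℕ) (u : List ℕ) : Prop :=
  ∀ i w, 1 ≤ i → g (u ++ i :: w) = g u ++ i :: w

/-- Membership in `S u` depends only on the part of the tree `c` above the positive children
of `u`. -/
def Equivar (L : FirstOrder.Language.{u, u}) {𝕄 : Type u} [L.Structure 𝕄]
    (c : List ℕ → Fin m → 𝕄) (S : List ℕ → Set (γ → 𝕄)) : Prop :=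
  ∀ g (σ : 𝕄 ≃[L] 𝕄) u, Moves c σ g → GoodAt g u → ∀ Ξ, Ξ ∈ S u ↔ σ ∘ Ξ ∈ S (g u)

/-- The set `T` is invariant under changes of the part of the tree `c` above `a`. -/
def InvAbove (L : FirstOrder.Language.{u, u}) {𝕄 : Type u} [L.Structure 𝕄]
    (c : List ℕ → Fin m → 𝕄) (a : List ℕ) (T : Set (γ → 𝕄)) : Prop :=
  ∀ g (σ : 𝕄 ≃[L] 𝕄), (∀ v, ¬ a <+: v → g v = v) → Moves c σ g → ∀ Ξ, Ξ ∈ T ↔ σ ∘ Ξ ∈ T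

/-- The sets `S (a ++ [0, …, 0])` are finitely consistent with `T`. -/
def ChainCons (S : List ℕ → Set (γ → 𝕄)) (a : List ℕ) (T : Set (γ → 𝕄)) : Prop :=
  ∀ N : ℕ, ∃ Ξ ∈ T, ∀ i ≤ N, Ξ ∈ S (a ++ List.replicate i 0)

variable {c : List ℕ → Fin m → 𝕄} {S : List ℕ → Set (γ → 𝕄)} {T T' : Set (γ → 𝕄)}
  {a : List ℕ}

theorem InvAbove.inter (h : InvAbove L c a T) (h' : InvAbove L c a T') :
    InvAbove L c a (T ∩ T') := fun g σ hg hσ Ξ => and_congr (h g σ hg hσ Ξ) (h' g σ hg hσ Ξ)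

theorem invAbove_univ : InvAbove L c a (Set.univ : Set (γ → 𝕄)) := fun _ _ _ _ _ => by simp

theorem InvAbove.forall_mem {κ : Type} {s : Set κ} {D : κ → Set (γ → 𝕄)}
    (h : ∀ t ∈ s, InvAbove L c a (D t)) : InvAbove L c a {v | ∀ t ∈ s, v ∈ D t} :=
  fun g σ hg hσ Ξ => forall₂_congr fun t ht => h t ht g σ hg hσ Ξ

theorem InvAbove.forall {κ : Type} {D : κ → Set (γ → 𝕄)} (h : ∀ t, InvAbove L c a (D t)) :
    InvAbove L c a {v | ∀ t, v ∈ D t} :=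
  fun g σ hg hσ Ξ => forall_congr' fun t => h t g σ hg hσ Ξ

theorem InvAbove.append (h : InvAbove L c a T) (s : List ℕ) : InvAbove L c (a ++ s) T :=
  fun g σ hg hσ Ξ => h g σ (fun v hv => hg v fun h' => hv ((List.prefix_append _ _).trans h')) hσ Ξ

theorem Equivar.invAbove (hS : Equivar L c S) {u : List ℕ} (h : Incomp a u) :
    InvAbove L c a (S u) := by
  intro g σ hg hσ Ξ
  have h1 : ∀ w, g (u ++ w) = u ++ w := fun w => hg _ (h.append_right w).1
  have h2 : g u = u := by simpa using h1 []
  have := hS g σ u hσ (fun i w _ => by rw [h1, h2]) Ξ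
  rwa [h2] at this

theorem InvAbove.graft_iff (h : InvAbove L c a T) {s X : List ℕ} {α : ℕ → ℕ} {W : ℕ → List ℕ}
    {σ : 𝕄 ≃[L] 𝕄} (hσ : Moves c σ (graft s X α W)) (hs : a <+: s) (Ξ : γ → 𝕄) :
    Ξ ∈ T ↔ σ ∘ Ξ ∈ T :=
  h _ σ (fun _ hv => graft_of_not_prefix _ _ _ _ fun h' => hv (hs.trans h')) hσ Ξ

theorem goodAt_graft_append_cons (a X : List ℕ) (α : ℕ → ℕ) (W : ℕ → List ℕ) (i : ℕ)
    (x : List ℕ) : GoodAt (graft a X α W) (a ++ i :: x) := by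
  intro j w _
  rw [List.append_assoc, List.cons_append, graft_append_cons, graft_append_cons]
  simp

theorem graft_of_append_zero_prefix {s u : List ℕ} (h : u ++ [0] <+: s) (X : List ℕ) (α : ℕ → ℕ)
    (W : ℕ → List ℕ) : graft s X α W u = u ∧ GoodAt (graft s X α W) u := by
  have h1 : graft s X α W u = u := by
    apply graft_of_not_prefix
    intro h'
    have := (h.trans h').length_le
    simp at this
  refine ⟨h1, fun i w hi => ?_⟩
  rw [h1]
  apply graft_of_not_prefix
  intro h'
  have := h.trans h'
  rw [List.prefix_append_right_inj, List.cons_prefix_cons] at this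
  omega

theorem graft_id_append (s X w : List ℕ) :
    graft s X id (fun _ => []) (s ++ w) = s ++ X ++ w := by
  cases w with
  | nil => simp [graft_self]
  | cons i w => simp [graft_append_cons]

theorem goodAt_graft_id (s X w : List ℕ) : GoodAt (graft s X id fun _ => []) (s ++ w) := by
  intro i w' _
  rw [List.append_assoc, graft_id_append, graft_id_append]
  simp

theorem Moves.symm_comp {σ : 𝕄 ≃[L] 𝕄} (Ξ : γ → 𝕄) : σ ∘ (σ.symm ∘ Ξ) = Ξ := by
  ext t
  simp

/-- The position of the node `ρ` of a binary tree in which consecutive levels are separated by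
`N + 1` zeros. -/
def spread (N : ℕ) (ρ : List Bool) : List ℕ :=
  ρ.flatMap fun e => List.replicate (N + 1) 0 ++ [e.toNat]

theorem spread_append_cons (N : ℕ) (ξ : List Bool) (e : Bool) (s : List Bool) :
    spread N (ξ ++ e :: s) =
      spread N ξ ++ List.replicate (N + 1) 0 ++ e.toNat :: spread N s := by
  simp [spread]

theorem spread_replicate_prefix {N : ℕ} {ν ρ : List Bool} (h : ν <+: ρ) :
    spread N ν ++ List.replicate (N + 1) 0 <+: spread N ρ ++ List.replicate (N + 1) 0 := by
  obtain ⟨t, rfl⟩ := h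
  cases t with
  | nil => simp
  | cons e t =>
    rw [spread_append_cons, List.append_assoc _ _ (List.replicate (N + 1) 0)]
    exact List.prefix_append _ _

theorem replicate_append_prefix {i n : ℕ} (h : i ≤ n) :
    List.replicate i 0 <+: List.replicate n 0 :=
  ⟨List.replicate (n - i) 0, by rw [List.replicate_append_replicate]; congr 1; omega⟩

theorem exists_split_of_not_hasSOP2 {κ : Cardinal.{u}} (hκ : Cardinal.aleph0 < κ)
    (hsat : IsSaturated L 𝕄 κ) (hno : ¬ HasSOP2 L 𝕄) (hc : TreeHomogeneous L c)
    (hSdef : UnifDef L S) (hTdef : UnifDef L fun _ : Unit => T) (hT : InvAbove L c a T)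
    (hS : Equivar L c S) (hch : ChainCons S a T) (N : ℕ) :
    ∃ Ξ ∈ T, (∀ i ≤ N, Ξ ∈ S (a ++ 0 :: List.replicate i 0)) ∧
      ∀ i ≤ N, Ξ ∈ S (a ++ 1 :: List.replicate i 0) := by
  by_contra hcon
  refine hno (UnifDef.hasSOP2 hκ hsat (D := fun ρ => T ∩ {Ξ | ∀ i : Fin (N + 1),
    Ξ ∈ S (a ++ spread N ρ ++ List.replicate i 0)}) ?_ ?_ ?_)
  · exact (hTdef.comp fun _ => ()).inter (UnifDef.forall fun i =>
      hSdef.comp fun ρ => a ++ spread N ρ ++ List.replicate i 0)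
  · have key : ∀ ρ : List Bool, ∀ N', ∃ Ξ ∈ T,
        (∀ ν, ν <+: ρ → ∀ i ≤ N, Ξ ∈ S (a ++ spread N ν ++ List.replicate i 0)) ∧
        ∀ i ≤ N', Ξ ∈ S (a ++ spread N ρ ++ List.replicate i 0) := by
      intro ρ
      induction ρ using List.reverseRecOn with
      | nil =>
        intro N'
        obtain ⟨Ξ, hΞT, hΞ⟩ := hch (max N N')
        refine ⟨Ξ, hΞT, ?_, ?_⟩
        · intro ν hν i hi
          rw [List.prefix_nil.1 hν]
          simpa [spread] using hΞ i (by omega)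
        · intro i hi
          simpa [spread] using hΞ i (by omega)
      | append_singleton ρ e ih =>
        intro N'
        obtain ⟨Ξ, hΞT, hΞ1, hΞ2⟩ := ih (N + 1 + max N N')
        set s := a ++ spread N ρ ++ List.replicate (N + 1) 0 with hs
        obtain ⟨σ, hσ⟩ := hc _ (treeEmb_graft s [e.toNat] (fun _ => []) strictMono_id)
        have h1 : ∀ i, a ++ spread N (ρ ++ [e]) ++ List.replicate i 0 =
            graft s [e.toNat] id (fun _ => []) (s ++ List.replicate i 0) := by
          intro i
          rw [graft_id_append, spread_append_cons, hs]
          simp [spread]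
        have h2 : ∀ i ≤ max N N', σ ∘ Ξ ∈ S (a ++ spread N (ρ ++ [e]) ++ List.replicate i 0) := by
          intro i hi
          rw [h1, ← hS _ σ _ hσ (goodAt_graft_id _ _ _)]
          have := hΞ2 (N + 1 + i) (by omega)
          rwa [← List.replicate_append_replicate, ← List.append_assoc] at this
        refine ⟨σ ∘ Ξ, (hT.graft_iff hσ (by simp [hs, List.append_assoc]) Ξ).1 hΞT, ?_,
          fun i hi => h2 i (by omega)⟩
        intro ν hν i hi
        rcases List.prefix_concat_iff.1 hν with rfl | hν
        · exact h2 i (by omega)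
        · have h3 : a ++ spread N ν ++ List.replicate i 0 ++ [0] <+: s := by
            rw [hs, List.append_assoc, List.append_assoc, List.append_assoc,
              List.prefix_append_right_inj, ← List.replicate_succ']
            refine List.IsPrefix.trans ?_ (spread_replicate_prefix hν)
            rw [List.prefix_append_right_inj]
            exact replicate_append_prefix (by omega)
          obtain ⟨h4, h5⟩ := graft_of_append_zero_prefix h3 [e.toNat] id fun _ => []
          have := (hS _ σ _ hσ h5 Ξ).1 (hΞ1 ν hν i hi)
          rwa [h4] at this
    intro w
    obtain ⟨Ξ, hΞT, hΞ, -⟩ := key w 0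
    exact ⟨Ξ, fun v hv => ⟨hΞT, fun i => hΞ v hv i (by omega)⟩⟩
  · rintro ξ s s' ⟨Ξ, ⟨hΞT, hΞ1⟩, -, hΞ2⟩
    let W : ℕ → List ℕ := fun i => if i = 0 then spread N s else spread N s'
    obtain ⟨σ, hσ⟩ := hc _ (treeEmb_graft a (spread N ξ ++ List.replicate (N + 1) 0) W
      strictMono_id)
    refine hcon ⟨σ.symm ∘ Ξ, ?_, ?_, ?_⟩
    · rw [hT.graft_iff hσ (List.prefix_refl _), Moves.symm_comp]
      exact hΞT
    · intro i hi
      rw [hS _ σ _ hσ (goodAt_graft_append_cons _ _ _ _ _ _), Moves.symm_comp,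
        graft_append_cons]
      have := hΞ1 ⟨i, by omega⟩
      rw [spread_append_cons] at this
      simpa [W] using this
    · intro i hi
      rw [hS _ σ _ hσ (goodAt_graft_append_cons _ _ _ _ _ _), Moves.symm_comp,
        graft_append_cons]
      have := hΞ2 ⟨i, by omega⟩
      rw [spread_append_cons] at this
      simpa [W] using this

theorem exists_antichain_of_not_hasSOP2 {κ : Cardinal.{u}} (hκ : Cardinal.aleph0 < κ)
    (hsat : IsSaturated L 𝕄 κ) (hno : ¬ HasSOP2 L 𝕄) (hc : TreeHomogeneous L c)
    (hSdef : UnifDef L S) (hS : Equivar L c S) (n : ℕ) :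
    ∀ (a : List ℕ) (T : Set (γ → 𝕄)) (_ : UnifDef L fun _ : Unit => T) (_ : InvAbove L c a T)
      (_ : ChainCons S a T) (B : Set (List ℕ)) (_ : B.Finite)
      (_ : ∀ β ∈ B, ∀ β' ∈ B, β ≠ β' → Incomp β β') (_ : ∀ β ∈ B, β.length ≤ n)
      (_ : ∀ β ∈ B, ∀ i ∈ β, i ≤ 1) (N : ℕ),
      ∃ Ξ ∈ T, ∀ β ∈ B, ∀ i ≤ N, Ξ ∈ S (a ++ β ++ List.replicate i 0) := by
  induction n with
  | zero =>
    intro a T _ _ hch B _ _ hlen _ N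
    obtain ⟨Ξ, hΞT, hΞ⟩ := hch N
    refine ⟨Ξ, hΞT, fun β hβ i hi => ?_⟩
    rw [List.length_eq_zero_iff.1 (Nat.le_zero.1 (hlen β hβ)), List.append_nil]
    exact hΞ i hi
  | succ n ih =>
    intro a T hTdef hT hch B hB hanti hlen hdig N
    by_cases hnil : [] ∈ B
    · obtain ⟨Ξ, hΞT, hΞ⟩ := hch N
      refine ⟨Ξ, hΞT, fun β hβ i hi => ?_⟩
      have : β = [] := by
        by_contra hne
        exact (hanti β hβ [] hnil hne).2 List.nil_prefix
      rw [this, List.append_nil]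
      exact hΞ i hi
    have hsub : ∀ e : ℕ, ((e :: ·) ⁻¹' B).Finite ∧
        (∀ β ∈ (e :: ·) ⁻¹' B, ∀ β' ∈ (e :: ·) ⁻¹' B, β ≠ β' → Incomp β β') ∧
        (∀ β ∈ (e :: ·) ⁻¹' B, β.length ≤ n) ∧ ∀ β ∈ (e :: ·) ⁻¹' B, ∀ i ∈ β, i ≤ 1 := by
      intro e
      refine ⟨hB.preimage (List.cons_injective.injOn), ?_, ?_, ?_⟩
      · intro β hβ β' hβ' hne
        exact incomp_cons_iff.1 (hanti _ hβ _ hβ' (by simpa using hne))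
      · intro β hβ
        have := hlen _ hβ
        simpa using this
      · intro β hβ i hi
        exact hdig _ hβ i (List.mem_cons_of_mem _ hi)
    have hsplit := exists_split_of_not_hasSOP2 hκ hsat hno hc hSdef hTdef hT hS hch
    obtain ⟨hf0, ha0, hl0, hd0⟩ := hsub 0
    obtain ⟨hf1, ha1, hl1, hd1⟩ := hsub 1
    have step0 : ∀ N', ∃ Ξ ∈ T, (∀ i ≤ N', Ξ ∈ S (a ++ 1 :: List.replicate i 0)) ∧
        ∀ β ∈ (0 :: ·) ⁻¹' B, ∀ i ≤ N, Ξ ∈ S (a ++ 0 :: β ++ List.replicate i 0) := by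
      intro N'
      obtain ⟨Ξ, ⟨hΞT, hΞ1⟩, hΞ0⟩ := ih (a ++ [0])
        (T ∩ {Ξ | ∀ i ∈ Set.Iic N', Ξ ∈ S (a ++ 1 :: List.replicate i 0)})
        (hTdef.inter (UnifDef.forall_finite (Set.finite_Iic N') fun i _ => hSdef.comp _))
        ((hT.append _).inter (InvAbove.forall_mem fun i _ => hS.invAbove
          (incomp_append_iff.2 (incomp_cons (by decide) _ _))))
        (by
          intro N''
          obtain ⟨Ξ, hΞT, hΞ0, hΞ1⟩ := hsplit (max N' N'')
          refine ⟨Ξ, ⟨hΞT, fun i hi => hΞ1 i (le_trans hi (le_max_left _ _))⟩, fun i hi => ?_⟩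
          simpa using hΞ0 i (by omega))
        _ hf0 ha0 hl0 hd0 N
      refine ⟨Ξ, hΞT, hΞ1, fun β hβ i hi => ?_⟩
      simpa using hΞ0 β hβ i hi
    obtain ⟨Ξ, ⟨hΞT, hΞ0⟩, hΞ1⟩ := ih (a ++ [1])
      (T ∩ {Ξ | ∀ β ∈ (0 :: ·) ⁻¹' B, Ξ ∈ {Ξ | ∀ i ∈ Set.Iic N,
        Ξ ∈ S (a ++ 0 :: β ++ List.replicate i 0)}})
      (hTdef.inter (UnifDef.forall_finite hf0 fun β _ =>
        UnifDef.forall_finite (Set.finite_Iic N) fun i _ => hSdef.comp _))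
      ((hT.append _).inter (InvAbove.forall_mem fun β _ => InvAbove.forall_mem fun i _ =>
        hS.invAbove (by
          rw [List.append_assoc]
          exact incomp_append_iff.2 (incomp_cons (by decide) _ _))))
      (by
        intro N''
        obtain ⟨Ξ, hΞT, hΞ1, hΞ0⟩ := step0 N''
        refine ⟨Ξ, ⟨hΞT, hΞ0⟩, fun i hi => ?_⟩
        simpa using hΞ1 i hi)
      _ hf1 ha1 hl1 hd1 N
    refine ⟨Ξ, hΞT, fun β hβ i hi => ?_⟩
    rcases β with _ | ⟨e, β⟩
    · exact absurd hβ hnil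
    · have := hdig _ hβ e (by simp)
      interval_cases e
      · exact hΞ0 β hβ i hi
      · simpa using hΞ1 β hβ i hi

end Move

/-! ### Accepting a chain of nodes -/

section Accept

variable {L : FirstOrder.Language.{u, u}} {𝕄 : Type u} [L.Structure 𝕄] {r m k : ℕ}

theorem realize_equiv (φ : L.Formula (Fin r ⊕ Fin m)) (σ : 𝕄 ≃[L] 𝕄) (x : Fin r → 𝕄)
    (y : Fin m → 𝕄) :
    φ.Realize (Sum.elim (σ ∘ x) (σ ∘ y)) ↔ φ.Realize (Sum.elim x y) := by
  rw [← Sum.comp_elim]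
  exact StrongHomClass.realize_formula σ φ

theorem Moves.comp_eq {c : List ℕ → Fin m → 𝕄} {σ : 𝕄 ≃[L] 𝕄} {g : List ℕ → List ℕ}
    (h : Moves c σ g) (u : List ℕ) : σ ∘ c u = c (g u) := funext (h u)

theorem Moves.realize_iff {c : List ℕ → Fin m → 𝕄} {σ : 𝕄 ≃[L] 𝕄} {g : List ℕ → List ℕ}
    (h : Moves c σ g) (φ : L.Formula (Fin r ⊕ Fin m)) (x : Fin r → 𝕄) (u : List ℕ) :
    φ.Realize (Sum.elim x (c u)) ↔ φ.Realize (Sum.elim (σ ∘ x) (c (g u))) := by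
  rw [← h.comp_eq, realize_equiv]

variable (φ : L.Formula (Fin r ⊕ Fin m)) (c : List ℕ → Fin m → 𝕄)

/-- The set defined by the instance of `φ` at the node `u`. -/
def nodeSet (u : List ℕ) : Set (Fin r → 𝕄) := {x | φ.Realize (Sum.elim x (c u))}

theorem unifDef_nodeSet : UnifDef L (nodeSet φ c) := unifDef_realize φ id c

theorem equivar_nodeSet : Equivar L c (nodeSet φ c) :=
  fun _ _ u hσ _ Ξ => hσ.realize_iff φ Ξ u

variable {φ c}

theorem invAbove_nodeSet {a u : List ℕ} (h : ¬ a <+: u) : InvAbove L c a (nodeSet φ c u) := by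
  intro g σ hg hσ x
  have := hσ.realize_iff φ x u
  rwa [hg u h] at this

theorem exists_strictMono_extend {k : ℕ} {n : Fin k → ℕ} (hn : StrictMono n) :
    ∃ α : ℕ → ℕ, StrictMono α ∧ ∀ j : Fin k, α (j + 2) = n j + 2 := by
  refine ⟨fun i => if i < 2 then i else if h : i - 2 < k then n ⟨i - 2, h⟩ + 2 else
    i + 2 + ∑ j, n j, ?_, ?_⟩
  · have hle : ∀ j, n j ≤ ∑ j, n j := fun j =>
      Finset.single_le_sum (f := n) (fun _ _ => Nat.zero_le _) (Finset.mem_univ j)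
    intro i i' hi
    dsimp only
    split_ifs with h1 h2 h3 h4 h5 h6 h7 h8
    all_goals try omega
    · have : (⟨i - 2, h4⟩ : Fin k) < ⟨i' - 2, h6⟩ := by simp; omega
      have := hn this
      omega
    · have := hle ⟨i - 2, h4⟩
      omega
  · intro j
    simp

theorem exists_fan_of_not_hasWeakKTP1 {κ : Cardinal.{u}} (hκ : Cardinal.aleph0 < κ)
    (hsat : IsSaturated L 𝕄 κ) (hk : 2 ≤ k) (hno : ¬ HasWeakKTP1 L 𝕄 k)
    (hc : TreeHomogeneous L c) {a : List ℕ} {T : Set (Fin r → 𝕄)}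
    (hTdef : UnifDef L fun _ : Unit => T) (hT : InvAbove L c a T)
    (hch : ChainCons (nodeSet φ c) a T) :
    ∃ x ∈ T, ∀ j : Fin k, x ∈ nodeSet φ c (a ++ [(j : ℕ) + 2]) := by
  by_contra hcon
  refine hno (UnifDef.hasWeakKTP1 hκ hsat hk
    (D := fun ρ => T ∩ nodeSet φ c (a ++ ρ.map (· + 2))) ?_ ?_ ?_)
  · exact (hTdef.comp fun _ => ()).inter ((unifDef_nodeSet φ c).comp _)
  · have key : ∀ ρ : List ℕ, ∀ N', ∃ x ∈ T,
        (∀ ν, ν <+: ρ → x ∈ nodeSet φ c (a ++ ν.map (· + 2))) ∧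
        ∀ i ≤ N', x ∈ nodeSet φ c (a ++ ρ.map (· + 2) ++ List.replicate i 0) := by
      intro ρ
      induction ρ using List.reverseRecOn with
      | nil =>
        intro N'
        obtain ⟨x, hxT, hx⟩ := hch N'
        refine ⟨x, hxT, ?_, ?_⟩
        · intro ν hν
          rw [List.prefix_nil.1 hν]
          exact hx 0 (Nat.zero_le _)
        · intro i hi
          simpa using hx i hi
      | append_singleton ρ e ih =>
        intro N'
        obtain ⟨x, hxT, hx1, hx2⟩ := ih (N' + 1)
        set s := a ++ ρ.map (· + 2) with hs
        have hα : StrictMono (· + e + 2) := fun i j h => by simpa using h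
        obtain ⟨σ, hσ⟩ := hc _ (treeEmb_graft s [] (fun _ => []) hα)
        have h1 : ∀ i ≤ N', σ ∘ x ∈
            nodeSet φ c (a ++ (ρ ++ [e]).map (· + 2) ++ List.replicate i 0) := by
          intro i hi
          have := (hσ.realize_iff φ x _).1 (hx2 (i + 1) (by omega))
          rw [List.replicate_succ, graft_append_cons] at this
          simpa [hs, nodeSet] using this
        refine ⟨σ ∘ x, (hT.graft_iff hσ (by simp [hs]) x).1 hxT, ?_, h1⟩
        intro ν hν
        rcases List.prefix_concat_iff.1 hν with rfl | hν
        · simpa using h1 0 (Nat.zero_le _)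
        · have h2 := (hσ.realize_iff φ x _).1 (hx1 ν hν)
          have h3 : a ++ ν.map (· + 2) <+: s := by
            rw [hs, List.prefix_append_right_inj]
            exact hν.map _
          have h4 : graft s [] (· + e + 2) (fun _ => []) (a ++ ν.map (· + 2)) =
              a ++ ν.map (· + 2) := by
            by_cases h : s <+: a ++ ν.map (· + 2)
            · rw [← List.IsPrefix.eq_of_length_le h3 h.length_le, graft_self, List.append_nil]
            · exact graft_of_not_prefix _ _ _ _ h
          rwa [h4] at h2
    intro w
    obtain ⟨x, hxT, hx, -⟩ := key w 0
    exact ⟨x, fun v hv => ⟨hxT, hx v hv⟩⟩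
  · rintro ξ n hn s ⟨x, hx⟩
    obtain ⟨α, hα, hαn⟩ := exists_strictMono_extend hn
    let W : ℕ → List ℕ := fun i => if h : i - 2 < k then (s ⟨i - 2, h⟩).map (· + 2) else []
    obtain ⟨σ, hσ⟩ := hc _ (treeEmb_graft a (ξ.map (· + 2)) W hα)
    refine hcon ⟨σ.symm ∘ x, ?_, fun j => ?_⟩
    · rw [hT.graft_iff hσ (List.prefix_refl _), Moves.symm_comp]
      exact (hx ⟨0, by omega⟩).1
    · have := hσ.realize_iff φ (σ.symm ∘ x) (a ++ [(j : ℕ) + 2])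
      rw [Moves.symm_comp, graft_append_cons, hαn] at this
      refine this.2 ?_
      simpa [W, nodeSet] using (hx j).2

theorem exists_fans_of_not_hasWeakKTP1 {κ : Cardinal.{u}} (hκ : Cardinal.aleph0 < κ)
    (hsat : IsSaturated L 𝕄 κ) (hk : 2 ≤ k) (hno : ¬ HasWeakKTP1 L 𝕄 k)
    (hc : TreeHomogeneous L c) (A : Finset (List ℕ)) :
    ∀ (T : Set (Fin r → 𝕄)) (_ : UnifDef L fun _ : Unit => T) (_ : ∀ a ∈ A, InvAbove L c a T)
      (_ : ∀ a ∈ A, ∀ b ∈ A, a ≠ b → Incomp a b)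
      (_ : ∀ N : ℕ, ∃ x ∈ T, ∀ a ∈ A, ∀ i ≤ N, x ∈ nodeSet φ c (a ++ List.replicate i 0)),
      ∃ x ∈ T, ∀ a ∈ A, ∀ j : Fin k, x ∈ nodeSet φ c (a ++ [(j : ℕ) + 2]) := by
  induction A using Finset.induction_on with
  | empty =>
    intro T _ _ _ hch
    obtain ⟨x, hxT, -⟩ := hch 0
    exact ⟨x, hxT, by simp⟩
  | insert a A ha ih =>
    intro T hTdef hT hA hch
    have hne : ∀ b ∈ A, Incomp a b := fun b hb => hA a (by simp) b (by simp [hb])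
      (by rintro rfl; exact ha hb)
    have h1 : ChainCons (nodeSet φ c) a
        (T ∩ {x | ∀ b ∈ (A : Set (List ℕ)), x ∈ {x | ∀ j : Fin k, x ∈ nodeSet φ c (b ++ [(j : ℕ) + 2])}}) := by
      intro N
      obtain ⟨x, ⟨hxT, hx1⟩, hx2⟩ := ih
        (T ∩ {x | ∀ i ∈ Set.Iic N, x ∈ nodeSet φ c (a ++ List.replicate i 0)})
        (hTdef.inter (UnifDef.forall_finite (Set.finite_Iic N) fun i _ =>
          (unifDef_nodeSet φ c).comp _))
        (fun b hb => (hT b (by simp [hb])).inter (InvAbove.forall_mem fun i _ =>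
          invAbove_nodeSet ((hne b hb).append_left _).2))
        (fun b hb b' hb' => hA b (by simp [hb]) b' (by simp [hb']))
        (by
          intro N'
          obtain ⟨x, hxT, hx⟩ := hch (max N N')
          exact ⟨x, ⟨hxT, fun i hi => hx a (by simp) i (le_trans hi (le_max_left _ _))⟩,
            fun b hb i hi => hx b (by simp [hb]) i (by omega)⟩)
      exact ⟨x, ⟨hxT, hx2⟩, fun i hi => hx1 i hi⟩
    obtain ⟨x, ⟨hxT, hx1⟩, hx2⟩ := exists_fan_of_not_hasWeakKTP1 hκ hsat hk hno hc
      (hTdef.inter (UnifDef.forall_finite A.finite_toSet fun b _ => UnifDef.forall fun j =>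
        (unifDef_nodeSet φ c).comp _))
      ((hT a (by simp)).inter (InvAbove.forall_mem fun b hb => InvAbove.forall fun j =>
        invAbove_nodeSet ((hne b hb).append_right _).1)) h1
    refine ⟨x, hxT, fun b hb => ?_⟩
    rcases Finset.mem_insert.1 hb with rfl | hb
    · exact hx2
    · exact hx1 b hb

theorem incomp_replicate_append {i j : ℕ} (h : i ≠ j) (s t : List ℕ) :
    Incomp (List.replicate i 0 ++ 1 :: s) (List.replicate j 0 ++ 1 :: t) := by
  wlog hij : i < j generalizing i j s t
  · exact (this h.symm t s (by omega)).symm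
  obtain ⟨d, rfl⟩ := Nat.exists_eq_add_of_lt hij
  rw [show i + d + 1 = i + (d + 1) by omega, ← List.replicate_append_replicate, List.append_assoc,
    List.replicate_succ]
  exact incomp_append_iff.2 (incomp_cons (by decide) _ _)

variable (k φ c) in
/-- The set of `x` satisfying `φ` at the node `u ++ [1, 1]` and at `k` fixed children of the
node `u ++ [1, 0]`. -/
def Accepts (x : Fin r → 𝕄) (u : List ℕ) : Prop :=
  φ.Realize (Sum.elim x (c (u ++ [1, 1]))) ∧
    ∀ j : Fin k, φ.Realize (Sum.elim x (c (u ++ [1, 0, (j : ℕ) + 2])))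

theorem exists_accepts {κ : Cardinal.{u}} (hκ : Cardinal.aleph0 < κ)
    (hsat : IsSaturated L 𝕄 κ) (hk : 2 ≤ k) (hno2 : ¬ HasSOP2 L 𝕄) (hno : ¬ HasWeakKTP1 L 𝕄 k)
    (hc : TreeHomogeneous L c) (hpath : ConsPath φ c) (N : ℕ) :
    ∃ x, ∀ i ≤ N, Accepts k φ c x (List.replicate i 0) := by
  let A : Finset (List ℕ) := (Finset.range (N + 1)).image fun i => List.replicate i 0 ++ [1, 0]
  let B : Set (List ℕ) := ⋃ i ∈ Set.Iic N,
    {List.replicate i 0 ++ [1, 0], List.replicate i 0 ++ [1, 1]}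
  have hB : ∀ β, β ∈ B ↔ ∃ i ≤ N, ∃ e ≤ 1, β = List.replicate i 0 ++ [1, e] := by
    intro β
    simp only [B, Set.mem_iUnion, Set.mem_Iic, exists_prop, Set.mem_insert_iff,
      Set.mem_singleton_iff]
    refine exists_congr fun i => and_congr_right fun _ => ⟨?_, ?_⟩
    · rintro (h | h)
      · exact ⟨0, by omega, h⟩
      · exact ⟨1, by omega, h⟩
    · rintro ⟨e, he, h⟩
      interval_cases e
      · exact Or.inl h
      · exact Or.inr h
  have h1 := exists_antichain_of_not_hasSOP2 hκ hsat hno2 hc (unifDef_nodeSet φ c)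
    (equivar_nodeSet φ c) (N + 2) [] Set.univ unifDef_univ invAbove_univ
    (by
      intro N
      obtain ⟨x, hx⟩ := hpath (List.replicate N 0)
      exact ⟨x, trivial, fun i hi => hx _ (replicate_append_prefix hi)⟩)
    B ((Set.finite_Iic N).biUnion fun i _ => Set.toFinite _)
    (by
      intro β hβ β' hβ' hne
      obtain ⟨i, hi, e, he, rfl⟩ := (hB _).1 hβ
      obtain ⟨i', hi', e', he', rfl⟩ := (hB _).1 hβ'
      by_cases hii : i = i'
      · subst hii
        refine incomp_append_iff.2 (incomp_cons_iff.2 (incomp_cons ?_ _ _))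
        rintro rfl
        exact hne rfl
      · exact incomp_replicate_append hii _ _)
    (by
      intro β hβ
      obtain ⟨i, hi, e, he, rfl⟩ := (hB _).1 hβ
      simpa using hi)
    (by
      intro β hβ j hj
      obtain ⟨i, hi, e, he, rfl⟩ := (hB _).1 hβ
      simp at hj
      omega)
  obtain ⟨x, hx1, hx2⟩ := exists_fans_of_not_hasWeakKTP1 (φ := φ) hκ hsat hk hno hc A
    {x | ∀ i ∈ Set.Iic N, x ∈ nodeSet φ c (List.replicate i 0 ++ [1, 1])}
    (UnifDef.forall_finite (Set.finite_Iic N) fun i _ => (unifDef_nodeSet φ c).comp _)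
    (by
      intro a ha
      obtain ⟨i, hi, rfl⟩ := Finset.mem_image.1 ha
      refine InvAbove.forall_mem fun i' _ => invAbove_nodeSet ?_
      by_cases hii : i = i'
      · subst hii
        exact (incomp_append_iff.2 (incomp_cons_iff.2 (incomp_cons (by decide) _ _))).1
      · exact (incomp_replicate_append hii _ _).1)
    (by
      intro a ha b hb hne
      obtain ⟨i, hi, rfl⟩ := Finset.mem_image.1 ha
      obtain ⟨i', hi', rfl⟩ := Finset.mem_image.1 hb
      refine incomp_replicate_append (fun h => hne (by rw [h])) _ _)
    (by
      intro N'
      obtain ⟨x, -, hx⟩ := h1 N'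
      refine ⟨x, fun i hi => ?_, fun a ha i' hi' => ?_⟩
      · simpa using hx _ ((hB _).2 ⟨i, hi, 1, le_rfl, rfl⟩) 0 (Nat.zero_le _)
      · obtain ⟨i, hi, rfl⟩ := Finset.mem_image.1 ha
        rw [Finset.mem_range] at hi
        simpa using hx _ ((hB _).2 ⟨i, by omega, 0, by omega, rfl⟩) i' hi')
  refine ⟨x, fun i hi => ⟨hx1 i hi, fun j => ?_⟩⟩
  have := hx2 _ (Finset.mem_image.2 ⟨i, Finset.mem_range.2 (by omega), rfl⟩) j
  simpa [nodeSet] using this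

end Accept

/-! ### Building finite binary trees -/

section Stage

variable {L : FirstOrder.Language.{u, u}} {𝕄 : Type u} [L.Structure 𝕄] {r m k : ℕ}

/-- The variables of a finite binary tree of tuples `y` together with realizations `x`. -/
abbrev StageVar (r m : ℕ) : Type := (List Bool × Fin m) ⊕ (List Bool × Fin r)

/-- The tuple `y` at the node `ν`. -/
def yPart (Ξ : StageVar r m → 𝕄) (ν : List Bool) : Fin m → 𝕄 := fun t => Ξ (Sum.inl (ν, t))

/-- The tuple `x` at the leaf `σ`. -/
def xPart (Ξ : StageVar r m → 𝕄) (σ : List Bool) : Fin r → 𝕄 := fun t => Ξ (Sum.inr (σ, t))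

/-- The tuples at `k` fixed children of the node `u`. -/
def fan (k : ℕ) (c : List ℕ → Fin m → 𝕄) (u : List ℕ) : Fin k → Fin m → 𝕄 :=
  fun j => c (u ++ [(j : ℕ) + 2])

/-- The pairs of a node and a leaf above it in the binary tree of height `M`. -/
def belowPairs (M : ℕ) : Set (List Bool × List Bool) :=
  {p | p.1 <+: p.2 ∧ p.1.length < M ∧ p.2.length = M}

/-- The pairs of incomparable nodes in the binary tree of height `M`, from left to right. -/
def splitPairs (M : ℕ) : Set (List Bool × List Bool) :=
  {p | p.1.length < M ∧ p.2.length < M ∧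
    ∃ ξ ν η, p.1 = ξ ++ false :: ν ∧ p.2 = ξ ++ true :: η}

theorem finite_belowPairs (M : ℕ) : (belowPairs M).Finite :=
  ((List.finite_length_lt Bool M).prod (List.finite_length_eq Bool M)).subset
    fun _ hp => ⟨hp.2.1, hp.2.2⟩

theorem finite_splitPairs (M : ℕ) : (splitPairs M).Finite :=
  ((List.finite_length_lt Bool M).prod (List.finite_length_lt Bool M)).subset
    fun _ hp => ⟨hp.1, hp.2.1⟩

variable (k : ℕ) (φ : L.Formula (Fin r ⊕ Fin m)) (c : List ℕ → Fin m → 𝕄)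

/-- All nodes of the binary tree kill the fan at `u`, and all leaves accept `u`. -/
def stageSet (M : ℕ) (u : List ℕ) : Set (StageVar r m → 𝕄) :=
  {Ξ | ∀ ν ∈ {ν : List Bool | ν.length < M}, Kills φ (yPart Ξ ν) (fan k c u)} ∩
  {Ξ | ∀ σ ∈ {σ : List Bool | σ.length = M}, Accepts k φ c (xPart Ξ σ) u}

/-- The conditions on the binary tree of tuples `y` and fans at the nodes `f ν`, realized by the
leaves. -/
def stageTree (M : ℕ) (f : List Bool → List ℕ) : Set (StageVar r m → 𝕄) :=
  {Ξ | ∀ p ∈ belowPairs M, φ.Realize (Sum.elim (xPart Ξ p.2) (yPart Ξ p.1)) ∧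
    ∀ j, φ.Realize (Sum.elim (xPart Ξ p.2) (fan k c (f p.1) j))} ∩
  {Ξ | ∀ p ∈ splitPairs M, Kills φ (yPart Ξ p.2) (fan k c (f p.1))}

theorem unifDef_stageSet (M : ℕ) : UnifDef L (stageSet k φ c M) :=
  (UnifDef.forall_finite (List.finite_length_lt Bool M) fun ν _ =>
    unifDef_kills φ (fun t => Sum.inl (ν, t)) (fan k c)).inter
  (UnifDef.forall_finite (List.finite_length_eq Bool M) fun σ _ =>
    (unifDef_realize φ (fun t => Sum.inr (σ, t)) fun u => c (u ++ [1, 1])).inter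
    (UnifDef.forall fun j : Fin k =>
      unifDef_realize φ (fun t => Sum.inr (σ, t)) fun u => c (u ++ [1, 0, (j : ℕ) + 2])))

theorem unifDef_stageTree (M : ℕ) (f : List Bool → List ℕ) :
    UnifDef L fun _ : Unit => stageTree k φ c M f :=
  (UnifDef.forall_finite (finite_belowPairs M) fun p _ =>
    (unifDef_realize_self φ (fun t => Sum.inr (p.2, t)) fun t => Sum.inl (p.1, t)).inter
    (UnifDef.forall fun j : Fin k =>
      unifDef_realize φ (fun t => Sum.inr (p.2, t)) fun _ => fan k c (f p.1) j)).inter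
  (UnifDef.forall_finite (finite_splitPairs M) fun p _ =>
    unifDef_kills φ (fun t => Sum.inl (p.2, t)) fun _ => fan k c (f p.1))

variable {k φ c}

theorem kills_equiv (σ : 𝕄 ≃[L] 𝕄) (y : Fin m → 𝕄) (p : Fin k → Fin m → 𝕄) :
    Kills φ (σ ∘ y) (fun j => σ ∘ p j) ↔ Kills φ y p := by
  refine not_congr ⟨?_, ?_⟩
  · rintro ⟨x, h1, h2⟩
    refine ⟨σ.symm ∘ x, ?_, fun j => ?_⟩
    · rwa [← realize_equiv φ σ, Moves.symm_comp]
    · rw [← realize_equiv φ σ, Moves.symm_comp]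
      exact h2 j
  · rintro ⟨x, h1, h2⟩
    exact ⟨σ ∘ x, (realize_equiv φ σ _ _).2 h1, fun j => (realize_equiv φ σ _ _).2 (h2 j)⟩

theorem Moves.fan_eq {σ : 𝕄 ≃[L] 𝕄} {g : List ℕ → List ℕ} (hσ : Moves c σ g) {u u' : List ℕ}
    (h : ∀ j : Fin k, g (u ++ [(j : ℕ) + 2]) = u' ++ [(j : ℕ) + 2]) :
    fan k c u' = fun j => σ ∘ fan k c u j := by
  funext j
  rw [fan, fan, hσ.comp_eq, h]

theorem equivar_stageSet (M : ℕ) : Equivar L c (stageSet k φ c M) := by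
  intro g σ u hσ hg Ξ
  have h1 : ∀ ν, Kills φ (yPart Ξ ν) (fan k c u) ↔
      Kills φ (yPart (σ ∘ Ξ) ν) (fan k c (g u)) := by
    intro ν
    rw [hσ.fan_eq fun j : Fin k => hg (j + 2) [] (by omega)]
    exact (kills_equiv σ _ _).symm
  have h2 : ∀ τ, Accepts k φ c (xPart Ξ τ) u ↔ Accepts k φ c (xPart (σ ∘ Ξ) τ) (g u) := by
    intro τ
    refine and_congr ?_ (forall_congr' fun j => ?_)
    · rw [hσ.realize_iff, hg 1 [1] le_rfl]
      rfl
    · rw [hσ.realize_iff, hg 1 [0, (j : ℕ) + 2] le_rfl]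
      rfl
  exact and_congr (forall₂_congr fun ν _ => h1 ν) (forall₂_congr fun τ _ => h2 τ)

theorem Moves.stageTree_iff {σ : 𝕄 ≃[L] 𝕄} {g : List ℕ → List ℕ} (hσ : Moves c σ g) {M : ℕ}
    {f f' : List Bool → List ℕ} (h : ∀ ν : List Bool, ν.length < M → ∀ j : Fin k,
      g (f ν ++ [(j : ℕ) + 2]) = f' ν ++ [(j : ℕ) + 2]) (Ξ : StageVar r m → 𝕄) :
    Ξ ∈ stageTree k φ c M f ↔ σ ∘ Ξ ∈ stageTree k φ c M f' := by
  refine and_congr (forall₂_congr fun p hp => ?_) (forall₂_congr fun p hp => ?_)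
  · rw [hσ.fan_eq (h p.1 hp.2.1)]
    exact and_congr (realize_equiv φ σ _ _).symm
      (forall_congr' fun j => (realize_equiv φ σ _ _).symm)
  · rw [hσ.fan_eq (h p.1 hp.1)]
    exact (kills_equiv σ _ _).symm

theorem invAbove_stageTree {M : ℕ} {f : List Bool → List ℕ} {a : List ℕ}
    (h : ∀ ν : List Bool, ν.length < M → Incomp a (f ν)) :
    InvAbove L c a (stageTree k φ c M f) :=
  fun _ _ hg hσ Ξ => hσ.stageTree_iff (fun ν hν _ => hg _ ((h ν hν).append_right _).1) Ξ

theorem kills_of_incFan (hfan : IncFan (k + 1) φ c) {e : ℕ} (he : e ≤ 1) (ξ s : List ℕ) :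
    Kills φ (c (ξ ++ e :: s)) (fan k c ξ) := by
  rintro ⟨x, h1, h2⟩
  refine hfan ξ (Fin.cons e fun j : Fin k => (j : ℕ) + 2) ?_ (Fin.cons s fun _ => []) ⟨x, ?_⟩
  · rw [Fin.cons_injective_iff]
    refine ⟨?_, fun i j hij => by simpa [Fin.ext_iff] using hij⟩
    rintro ⟨j, hj⟩
    simp at hj
    omega
  · intro j
    cases j using Fin.cases with
    | zero => exact h1
    | succ j => exact h2 j

variable (k φ c) in
/-- The inductive hypothesis of the construction: there is a binary tree of height `M` that can be
continued along the chain above the node `a`. -/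
def Stage (M : ℕ) : Prop :=
  ∃ (f : List Bool → List ℕ) (a : List ℕ),
    (∀ ν : List Bool, ν.length < M → ∀ i ∈ f ν, i ≤ 1) ∧ (∀ i ∈ a, i ≤ 1) ∧
    (∀ ν ν' : List Bool, ν.length < M → ν'.length < M → ν ≠ ν' → Incomp (f ν) (f ν')) ∧
    (∀ ν : List Bool, ν.length < M → Incomp a (f ν)) ∧
    ChainCons (stageSet k φ c M) a (stageTree k φ c M f)

theorem stage_zero (h : ∀ N, ∃ x, ∀ i ≤ N, Accepts k φ c x (List.replicate i 0)) :
    Stage k φ c 0 := by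
  refine ⟨fun _ => [], [], by simp, by simp, by simp, by simp, fun N => ?_⟩
  obtain ⟨x, hx⟩ := h N
  refine ⟨Sum.elim (fun p => c [] p.2) fun p => x p.2, ⟨?_, ?_⟩, fun i hi => ⟨?_, ?_⟩⟩
  · rintro p ⟨-, h, -⟩
    exact absurd h (Nat.not_lt_zero _)
  · rintro p ⟨h, -⟩
    exact absurd h (Nat.not_lt_zero _)
  · intro ν h
    exact absurd h (Nat.not_lt_zero _)
  · intro σ _
    exact hx i hi

/-- The binary tree with root `y` and subtrees `Ξ₀`, `Ξ₁`. -/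
def joinTrees (y : Fin m → 𝕄) (Ξ₀ Ξ₁ : StageVar r m → 𝕄) : StageVar r m → 𝕄
  | Sum.inl ([], t) => y t
  | Sum.inl (false :: ν, t) => Ξ₀ (Sum.inl (ν, t))
  | Sum.inl (true :: ν, t) => Ξ₁ (Sum.inl (ν, t))
  | Sum.inr ([], t) => Ξ₀ (Sum.inr ([], t))
  | Sum.inr (false :: σ, t) => Ξ₀ (Sum.inr (σ, t))
  | Sum.inr (true :: σ, t) => Ξ₁ (Sum.inr (σ, t))

/-- The nodes of the tree of the next stage. -/
def nextNode (a : List ℕ) (f : List Bool → List ℕ) : List Bool → List ℕ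
  | [] => a ++ (a ++ [1, 1, 0])
  | false :: ν => a ++ f ν
  | true :: ν => f ν

theorem joinTrees_mem_stageSet {M : ℕ} {y : Fin m → 𝕄} {Ξ₀ Ξ₁ : StageVar r m → 𝕄} {u : List ℕ}
    (hy : Kills φ y (fan k c u)) (h₀ : Ξ₀ ∈ stageSet k φ c M u) (h₁ : Ξ₁ ∈ stageSet k φ c M u) :
    joinTrees y Ξ₀ Ξ₁ ∈ stageSet k φ c (M + 1) u := by
  constructor
  · rintro (_ | ⟨e, ν⟩) hν
    · exact hy
    · have hν' : ν.length < M := by simpa using hν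
      cases e
      · exact h₀.1 ν hν'
      · exact h₁.1 ν hν'
  · rintro (_ | ⟨e, σ⟩) hσ
    · simp at hσ
    · have hσ' : σ.length = M := by simpa using hσ
      cases e
      · exact h₀.2 σ hσ'
      · exact h₁.2 σ hσ'

theorem joinTrees_mem_stageTree {M : ℕ} {y : Fin m → 𝕄} {Ξ₀ Ξ₁ : StageVar r m → 𝕄} {a : List ℕ}
    {f : List Bool → List ℕ}
    (h₀ : Ξ₀ ∈ stageTree k φ c M fun ν => a ++ f ν) (h₁ : Ξ₁ ∈ stageTree k φ c M f)
    (hroot : ∀ Ξ : StageVar r m → 𝕄, Ξ = Ξ₀ ∨ Ξ = Ξ₁ → ∀ σ : List Bool, σ.length = M →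
      φ.Realize (Sum.elim (xPart Ξ σ) y) ∧
      ∀ j, φ.Realize (Sum.elim (xPart Ξ σ) (fan k c (a ++ (a ++ [1, 1, 0])) j)))
    (hkill : ∀ ν η : List Bool, ν.length < M → η.length < M →
      Kills φ (yPart Ξ₁ η) (fan k c (a ++ f ν))) :
    joinTrees y Ξ₀ Ξ₁ ∈ stageTree k φ c (M + 1) (nextNode a f) := by
  constructor
  · rintro ⟨ν, σ⟩ ⟨hνσ, hν, hσ⟩
    rcases σ with _ | ⟨e, σ⟩
    · simp at hσ
    have hσ' : σ.length = M := by simpa using hσ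
    rcases ν with _ | ⟨e', ν⟩
    · cases e
      · exact hroot Ξ₀ (Or.inl rfl) σ hσ'
      · exact hroot Ξ₁ (Or.inr rfl) σ hσ'
    · obtain ⟨rfl, hνσ'⟩ := List.cons_prefix_cons.1 hνσ
      have hν' : ν.length < M := by simpa using hν
      cases e'
      · exact h₀.1 (ν, σ) ⟨hνσ', hν', hσ'⟩
      · exact h₁.1 (ν, σ) ⟨hνσ', hν', hσ'⟩
  · rintro ⟨_, _⟩ ⟨hν, hη, ξ, ν, η, rfl, rfl⟩
    rcases ξ with _ | ⟨e, ξ⟩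
    · exact hkill ν η (by simpa using hν) (by simpa using hη)
    · have hν' : (ξ ++ false :: ν).length < M := Nat.lt_of_succ_lt_succ hν
      have hη' : (ξ ++ true :: η).length < M := Nat.lt_of_succ_lt_succ hη
      cases e
      · exact h₀.2 (ξ ++ false :: ν, ξ ++ true :: η) ⟨hν', hη', ξ, ν, η, rfl, rfl⟩
      · exact h₁.2 (ξ ++ false :: ν, ξ ++ true :: η) ⟨hν', hη', ξ, ν, η, rfl, rfl⟩

theorem stage_succ {κ : Cardinal.{u}} (hκ : Cardinal.aleph0 < κ) (hsat : IsSaturated L 𝕄 κ)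
    (hno2 : ¬ HasSOP2 L 𝕄) (hc : TreeHomogeneous L c) (hfan : IncFan (k + 1) φ c) {M : ℕ}
    (h : Stage k φ c M) : Stage k φ c (M + 1) := by
  obtain ⟨f, a, hf, ha, hff, haf, hch⟩ := h
  refine ⟨nextNode a f, a ++ (a ++ [0]), ?_, ?_, ?_, ?_, fun N => ?_⟩
  · rintro (_ | ⟨_ | _, ν⟩) hν i hi
    · simp only [nextNode, List.mem_append] at hi
      rcases hi with hi | hi | hi
      · exact ha i hi
      · exact ha i hi
      · simp at hi; omega
    · rcases List.mem_append.1 hi with hi | hi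
      · exact ha i hi
      · exact hf ν (by simpa using hν) i hi
    · exact hf ν (by simpa using hν) i hi
  · intro i hi
    simp only [List.mem_append] at hi
    rcases hi with hi | hi | hi
    · exact ha i hi
    · exact ha i hi
    · simp at hi; omega
  · have h1 : ∀ ν ν', ν.length < M → ν'.length < M →
        Incomp (nextNode a f (true :: ν)) (nextNode a f (false :: ν')) :=
      fun ν ν' hν _ => (haf ν hν).symm.append_right _
    have h2 : ∀ b ν, ν.length < M → Incomp (nextNode a f []) (nextNode a f (b :: ν)) := by
      rintro (_ | _) ν hν
      · exact incomp_append_iff.2 ((haf ν hν).append_left _)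
      · exact (haf ν hν).append_left _
    rintro (_ | ⟨b, ν⟩) (_ | ⟨b', ν'⟩) hν hν' hne
    · exact absurd rfl hne
    · exact h2 _ _ (by simpa using hν')
    · exact (h2 _ _ (by simpa using hν)).symm
    · have hν₁ : ν.length < M := by simpa using hν
      have hν₂ : ν'.length < M := by simpa using hν'
      cases b <;> cases b'
      · exact incomp_append_iff.2 (hff ν ν' hν₁ hν₂ (by simpa using hne))
      · exact (h1 _ _ hν₂ hν₁).symm
      · exact h1 _ _ hν₁ hν₂
      · exact hff ν ν' hν₁ hν₂ (by simpa using hne)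
  · rintro (_ | ⟨_ | _, ν⟩) hν
    · exact incomp_append_iff.2 (incomp_append_iff.2 (incomp_cons (by decide) _ _))
    · exact incomp_append_iff.2 ((haf ν (by simpa using hν)).append_left _)
    · exact (haf ν (by simpa using hν)).append_left _
  · have hinv := invAbove_stageTree (k := k) (φ := φ) (c := c) haf
    let B : Set (List ℕ) := (f '' {ν | ν.length < M}) ∪ {a ++ [0], a ++ [1]}
    have hBf : B.Finite := ((List.finite_length_lt Bool M).image f).union (Set.toFinite _)
    have hBa : ∀ β ∈ ({a ++ [0], a ++ [1]} : Set (List ℕ)), ∃ e ≤ 1, β = a ++ [e] := by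
      rintro β (rfl | rfl)
      · exact ⟨0, by omega, rfl⟩
      · exact ⟨1, by omega, rfl⟩
    obtain ⟨Ξ₁, hΞ₁T, hΞ₁⟩ := exists_antichain_of_not_hasSOP2 hκ hsat hno2 hc
      (unifDef_stageSet k φ c M) (equivar_stageSet M) (hBf.toFinset.sup List.length) a _
      (unifDef_stageTree k φ c M f) hinv hch B hBf
      (by
        rintro β (⟨ν, hν, rfl⟩ | hβ) β' (⟨ν', hν', rfl⟩ | hβ') hne
        · exact hff ν ν' hν hν' (by rintro rfl; exact hne rfl)
        · obtain ⟨e, -, rfl⟩ := hBa _ hβ'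
          exact (haf ν hν).symm.append_right _
        · obtain ⟨e, -, rfl⟩ := hBa _ hβ
          exact (haf ν' hν').append_left _
        · obtain ⟨e, -, rfl⟩ := hBa _ hβ
          obtain ⟨e', -, rfl⟩ := hBa _ hβ'
          exact incomp_append_iff.2 (incomp_cons (by rintro rfl; exact hne rfl) _ _))
      (fun β hβ => Finset.le_sup (f := List.length) (hBf.mem_toFinset.2 hβ))
      (by
        rintro β (⟨ν, hν, rfl⟩ | hβ) i hi
        · exact hf ν hν i hi
        · obtain ⟨e, he, rfl⟩ := hBa _ hβ
          rcases List.mem_append.1 hi with hi | hi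
          · exact ha i hi
          · simp at hi; omega) N
    obtain ⟨Ξ₀, hΞ₀T, hΞ₀0, hΞ₀1⟩ := exists_split_of_not_hasSOP2 hκ hsat hno2 hc
      (a := a ++ a) (S := stageSet k φ c M) (T := stageTree k φ c M fun ν => a ++ f ν)
      (unifDef_stageSet k φ c M) (unifDef_stageTree k φ c M _)
      (invAbove_stageTree fun ν hν => incomp_append_iff.2 (haf ν hν)) (equivar_stageSet M)
      (by
        intro N
        obtain ⟨Ξ, hΞT, hΞ⟩ := hch N
        obtain ⟨σ, hσ⟩ := hc _ (treeEmb_graft [] a (fun _ => []) strictMono_id)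
        have hg : ∀ w, graft [] a id (fun _ => []) w = a ++ w := fun w => by
          simpa using graft_id_append [] a w
        refine ⟨σ ∘ Ξ, (hσ.stageTree_iff (fun ν _ j => by rw [hg, List.append_assoc]) Ξ).1 hΞT,
          fun i hi => ?_⟩
        have := (equivar_stageSet M _ σ _ hσ
          (by simpa using goodAt_graft_id [] a (a ++ List.replicate i 0)) Ξ).1 (hΞ i hi)
        rwa [hg, ← List.append_assoc] at this) N
    have hΞ₁0 : ∀ i ≤ N, Ξ₁ ∈ stageSet k φ c M (a ++ (a ++ [0]) ++ List.replicate i 0) :=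
      fun i hi => hΞ₁ _ (Or.inr (Or.inl rfl)) i hi
    have hΞ₁1 : Ξ₁ ∈ stageSet k φ c M (a ++ (a ++ [1])) := by
      simpa using hΞ₁ _ (Or.inr (Or.inr rfl)) 0 (Nat.zero_le _)
    have hΞ₀0' : ∀ i ≤ N, Ξ₀ ∈ stageSet k φ c M (a ++ (a ++ [0]) ++ List.replicate i 0) := by
      intro i hi
      simpa using hΞ₀0 i hi
    have hΞ₀1' : Ξ₀ ∈ stageSet k φ c M (a ++ (a ++ [1])) := by
      simpa using hΞ₀1 0 (Nat.zero_le _)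
    refine ⟨joinTrees (c (a ++ (a ++ [0]) ++ List.replicate N 0 ++ [1, 1])) Ξ₀ Ξ₁,
      joinTrees_mem_stageTree hΞ₀T hΞ₁T ?_ ?_, fun i hi =>
        joinTrees_mem_stageSet ?_ (hΞ₀0' i hi) (hΞ₁0 i hi)⟩
    · intro Ξ hΞ σ hσ
      have h1 : Ξ ∈ stageSet k φ c M (a ++ (a ++ [0]) ++ List.replicate N 0) := by
        rcases hΞ with rfl | rfl
        · exact hΞ₀0' N le_rfl
        · exact hΞ₁0 N le_rfl
      have h2 : Ξ ∈ stageSet k φ c M (a ++ (a ++ [1])) := by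
        rcases hΞ with rfl | rfl
        · exact hΞ₀1'
        · exact hΞ₁1
      refine ⟨(h1.2 σ hσ).1, fun j => ?_⟩
      have := (h2.2 σ hσ).2 j
      simpa [fan] using this
    · intro ν η hν hη
      have := hΞ₁ (f ν) (Or.inl ⟨ν, hν, rfl⟩) 0 (Nat.zero_le _)
      rw [List.replicate_zero, List.append_nil] at this
      exact this.1 η hη
    · obtain ⟨d, rfl⟩ := Nat.exists_eq_add_of_le hi
      rw [← List.replicate_append_replicate, ← List.append_assoc _ (List.replicate i 0),
        List.append_assoc _ (List.replicate d 0)]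
      cases d with
      | zero => exact kills_of_incFan hfan le_rfl _ [1]
      | succ d => exact kills_of_incFan hfan (Nat.zero_le 1) _ _

end Stage

/-! ### The equivalence -/

section Main

variable {L : FirstOrder.Language.{u, u}} {𝕄 : Type u} [L.Structure 𝕄] {r m k : ℕ}

/-- The formula saying that `x` satisfies `φ` at `N` tuples. -/
noncomputable def allFormula (φ : L.Formula (Fin r ⊕ Fin m)) (N : ℕ) :
    L.Formula (Fin r ⊕ Fin (N * m)) :=
  Formula.iInf fun t : Fin N => φ.relabel (Sum.map id fun j => finProdFinEquiv (t, j))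

theorem realize_allFormula (φ : L.Formula (Fin r ⊕ Fin m)) (N : ℕ) (x : Fin r → 𝕄)
    (d : Fin N → Fin m → 𝕄) :
    (allFormula φ N).Realize
        (Sum.elim x fun t => d (finProdFinEquiv.symm t).1 (finProdFinEquiv.symm t).2) ↔
      ∀ t, φ.Realize (Sum.elim x (d t)) := by
  unfold allFormula
  rw [Formula.realize_iInf]
  refine forall_congr' fun t => ?_
  rw [Formula.realize_relabel, Sum.elim_comp_map]
  refine iff_of_eq (congrArg _ (congrArg _ (funext fun j => ?_)))
  simp only [Function.comp_apply, Equiv.symm_apply_apply]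

theorem hasSOP2_of_tree {κ : Cardinal.{u}} (hκ : Cardinal.aleph0 < κ)
    (hsat : IsSaturated L 𝕄 κ) {φ : L.Formula (Fin r ⊕ Fin m)} {c : List ℕ → Fin m → 𝕄}
    (hk : 2 ≤ k) (hc : TreeHomogeneous L c) (hpath : ConsPath φ c) (hfan : IncFan (k + 1) φ c)
    (hno : ¬ HasWeakKTP1 L 𝕄 k) : HasSOP2 L 𝕄 := by
  by_contra hno2
  have hstage : ∀ M, Stage k φ c M := by
    intro M
    induction M with
    | zero => exact stage_zero (exists_accepts hκ hsat hk hno2 hno hc hpath)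
    | succ M ih => exact stage_succ hκ hsat hno2 hc hfan ih
  refine hno2 (hasSOP2_of_finite_trees hκ hsat (allFormula φ (k + 1)) fun M => ?_)
  obtain ⟨f, a, -, -, -, -, hch⟩ := hstage M
  obtain ⟨Ξ, ⟨hΞ1, hΞ2⟩, -⟩ := hch 0
  refine ⟨fun ν t => (Fin.cons (yPart Ξ ν) (fan k c (f ν)) : Fin (k + 1) → Fin m → 𝕄)
    (finProdFinEquiv.symm t).1 (finProdFinEquiv.symm t).2, ?_, ?_⟩
  · intro w hw
    refine ⟨xPart Ξ (w ++ List.replicate (M - w.length) false), fun v hv => ?_⟩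
    rw [realize_allFormula, Fin.forall_fin_succ]
    exact hΞ1 (v, w ++ List.replicate (M - w.length) false)
      ⟨hv.trans (List.prefix_append _ _), hv.length_le.trans_lt hw, by simp; omega⟩
  · rintro ξ s s' hs hs' ⟨x, hx1, hx2⟩
    rw [realize_allFormula, Fin.forall_fin_succ] at hx1 hx2
    exact hΞ2 (ξ ++ false :: s, ξ ++ true :: s') ⟨hs, hs', ξ, s, s', rfl, rfl⟩ ⟨x, hx2.1, hx1.2⟩

theorem HasWeakKTP1.hasSOP2_of_two (h : HasWeakKTP1 L 𝕄 2) : HasSOP2 L 𝕄 := by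
  obtain ⟨r, m, φ, b, h1, h2⟩ := h
  refine ⟨r, m, φ, fun η => b (η.map Bool.toNat), fun σ => ?_, ?_⟩
  · obtain ⟨a, ha⟩ := h1 fun i => (σ i).toNat
    refine ⟨a, fun n => ?_⟩
    have := ha n
    change φ.Realize (Sum.elim a (b (List.map Bool.toNat (List.ofFn fun i : Fin n => σ i))))
    rwa [List.map_ofFn]
  · rintro η₁ η₂ h12 h21 ⟨a, ha1, ha2⟩
    obtain ⟨ξ, i, i', s, s', hi, rfl, rfl⟩ := Incomp.exists_split ⟨h12, h21⟩
    have hn : Function.Injective ![i.toNat, i'.toNat] := by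
      intro t t' htt
      fin_cases t <;> fin_cases t' <;> cases i <;> cases i' <;> simp_all
    obtain ⟨hη, hmeet⟩ := meet_append_cons_of_fan hn (ξ.map Bool.toNat)
      ![s.map Bool.toNat, s'.map Bool.toNat]
    refine h2 _ hη hmeet ⟨a, fun t => ?_⟩
    fin_cases t
    · simpa using ha1
    · simpa using ha2

theorem consPath_of_forall_seq {A : Type} [Inhabited A] {φ : L.Formula (Fin r ⊕ Fin m)}
    {b : List A → Fin m → 𝕄}
    (h : ∀ σ : ℕ → A, ∃ a : Fin r → 𝕄,
      ∀ n : ℕ, φ.Realize (Sum.elim a (b (List.ofFn fun i : Fin n => σ i)))) : ConsPath φ b := by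
  intro w
  obtain ⟨a, ha⟩ := h fun i => w.getD i default
  refine ⟨a, fun v hv => ?_⟩
  have : (List.ofFn fun i : Fin v.length => w.getD i default) = v := by
    apply List.ext_getElem
    · simp
    · intro i h1 h2
      rw [List.getElem_ofFn, List.getD_eq_getElem _ _ (h2.trans_le hv.length_le), hv.getElem]
  rw [← this]
  exact ha v.length

theorem HasWeakKTP1.hasSOP2 {κ : Cardinal.{u}} (hmon : IsMonster L 𝕄 κ) (hk : 2 ≤ k)
    (h : HasWeakKTP1 L 𝕄 k) : HasSOP2 L 𝕄 := by
  obtain ⟨hκ, hsat, hhom⟩ := hmon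
  induction k, hk using Nat.le_induction with
  | base => exact h.hasSOP2_of_two
  | succ k hk ih =>
    by_cases hno : HasWeakKTP1 L 𝕄 k
    · exact ih hno
    obtain ⟨r, m, φ, b, h1, h2⟩ := h
    obtain ⟨c, hpath, hfan, hc⟩ := exists_indiscernible_tree hκ hsat φ b
      (consPath_of_forall_seq h1) (K := k + 1) fun ξ n hn s => by
        obtain ⟨hη, hmeet⟩ := meet_append_cons_of_fan hn ξ s
        exact h2 _ hη hmeet
    exact hasSOP2_of_tree hκ hsat hk (fun g hg => exists_equiv_of_treeEmb hκ hhom hc hg)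
      hpath hfan hno

/-- The binary code of a sequence of natural numbers. -/
def unaryCode (v : List ℕ) : List Bool := v.flatMap fun n => List.replicate n true ++ [false]

theorem incomp_unaryCode {n n' : ℕ} (h : n < n') (ξ s s' : List ℕ) :
    Incomp (unaryCode (ξ ++ n :: s)) (unaryCode (ξ ++ n' :: s')) := by
  obtain ⟨d, rfl⟩ := Nat.exists_eq_add_of_lt h
  have key : ∀ n s, unaryCode (ξ ++ n :: s) =
      unaryCode ξ ++ (List.replicate n true ++ false :: unaryCode s) := by
    intro n s
    simp [unaryCode]
  rw [key, key, Nat.add_assoc, ← List.replicate_append_replicate, List.append_assoc,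
    List.replicate_succ]
  exact incomp_append_iff.2 (incomp_append_iff.2 (incomp_cons (by decide) _ _))

theorem HasSOP2.hasWeakKTP1 {κ : Cardinal.{u}} (hκ : Cardinal.aleph0 < κ)
    (hsat : IsSaturated L 𝕄 κ) (hk : 2 ≤ k) (h : HasSOP2 L 𝕄) : HasWeakKTP1 L 𝕄 k := by
  obtain ⟨r, m, φ, b, h1, h2⟩ := h
  refine UnifDef.hasWeakKTP1 hκ hsat hk
    (D := fun v => {x : Fin r → 𝕄 | φ.Realize (Sum.elim (x ∘ id) (b (unaryCode v)))})
    (unifDef_realize φ id _) ?_ ?_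
  · intro w
    obtain ⟨x, hx⟩ := consPath_of_forall_seq h1 (unaryCode w)
    refine ⟨x, fun v hv => hx _ ?_⟩
    obtain ⟨t, rfl⟩ := hv
    simp [unaryCode]
  · rintro ξ n hn s ⟨x, hx⟩
    have h01 : (⟨0, by omega⟩ : Fin k) < ⟨1, by omega⟩ := by simp
    obtain ⟨h3, h4⟩ := incomp_unaryCode (hn h01) ξ (s _) (s _)
    exact h2 _ _ h3 h4 ⟨x, hx _, hx _⟩

end Main

/-- **Corollary 2.9.** For any `k ≥ 2`, a complete first-order theory `T` has
weak `k`-`TP₁` if and only if it has `SOP₂`.  Stated in a monster model `𝕄`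
of `T = Th(𝕄)`. -/
theorem weak_ktp1_iff_sop2 (L : FirstOrder.Language.{u, u}) (𝕄 : Type u) [L.Structure 𝕄]
    (κ : Cardinal.{u}) (hmonster : IsMonster L 𝕄 κ)
    (k : ℕ) (hk : 2 ≤ k) : HasWeakKTP1 L 𝕄 k ↔ HasSOP2 L 𝕄 :=
  ⟨fun h => h.hasSOP2 hmonster hk, fun h => h.hasWeakKTP1 hmonster.1 hmonster.2.1 hk⟩

end NSOP2Paper
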